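/- arXiv:1407.5082 — 3 statements merged into one kernel-verified Lean document; each statement's English description precedes it below -/
import Mathlib

section
/- (Central limit theorem for the empirical measure.) Suppose the transition operator T is primitive and ψ ∈ ℂ^d is a unit vector, and let m ≥ 1. Then the function F : t ↦ log r(T̃_{t,m}) is twice differentiable at t = 0, and with p^{(m)} ∈ ℝ^{k^m} its gradient at t = 0 and V^{(m)} its Hessian matrix at t = 0, the random vectors √n ( P̂_n^{(m)} − p^{(m)} ) converge in distribution, as n → ∞, to the centered multivariate Gaussian distribution on ℝ^{k^m} with covariance matrix V^{(m)}. -/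
open Matrix Finset MeasureTheory
open scoped ComplexOrder Classical

/-- Product `V_{i_n} ⋯ V_{i_1}` of Kraus operators along a word `(i_1, …, i_n)`. -/
noncomputable def prodRev {d k n : ℕ} (V : Fin k → Matrix (Fin d) (Fin d) ℂ)
    (i : Fin n → Fin k) : Matrix (Fin d) (Fin d) ℂ :=
  ((List.ofFn i).reverse.map V).prod

/-- The transition operator `T(A) = ∑ᵢ Vᵢ* A Vᵢ` of the quantum Markov chain. -/
noncomputable def Tmap {d k : ℕ} (V : Fin k → Matrix (Fin d) (Fin d) ℂ)
    (A : Matrix (Fin d) (Fin d) ℂ) : Matrix (Fin d) (Fin d) ℂ :=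
  ∑ i : Fin k, (V i)ᴴ * A * V i

/-- Probability `P(X⁽¹⁾ = i₁, …, X⁽ⁿ⁾ = iₙ) = ‖V_{iₙ} ⋯ V_{i₁} ψ‖²` of an output trajectory. -/
noncomputable def outProb {d k n : ℕ} (V : Fin k → Matrix (Fin d) (Fin d) ℂ)
    (ψ : Fin d → ℂ) (i : Fin n → Fin k) : ℝ :=
  ∑ x : Fin d, ‖(prodRev V i *ᵥ ψ) x‖ ^ 2

/-- The extended transition operator `T_{t,m}` (with `m = m' + 1`). -/
noncomputable def extT {d k m' : ℕ} (V : Fin k → Matrix (Fin d) (Fin d) ℂ)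
    (t : (Fin (m' + 1) → Fin k) → ℝ)
    (Y : (Fin m' → Fin k) → Matrix (Fin d) (Fin d) ℂ) :
    (Fin m' → Fin k) → Matrix (Fin d) (Fin d) ℂ :=
  fun w => ∑ j : Fin k,
    (Real.exp (t (Fin.snoc w j)) : ℂ) •
      ((V ((Fin.snoc w j : Fin (m' + 1) → Fin k) 0))ᴴ *
        Y (Fin.tail (Fin.snoc w j : Fin (m' + 1) → Fin k)) *
        V ((Fin.snoc w j : Fin (m' + 1) → Fin k) 0))

/-- `M^{(m)}`, with `[M^{(m)}]_{i_1,…,i_{m-1}} = (V_{i_{m-1}} ⋯ V_{i_1})* (V_{i_{m-1}} ⋯ V_{i_1})`. -/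
noncomputable def Mmat {d k m' : ℕ} (V : Fin k → Matrix (Fin d) (Fin d) ℂ) :
    (Fin m' → Fin k) → Matrix (Fin d) (Fin d) ℂ :=
  fun w => (prodRev V w)ᴴ * prodRev V w

/-- The subspace `B_m = { Y : Y_w = Q_w Y_w Q_w for all words w }`. -/
noncomputable def Bsub {d k m' : ℕ} (Q : (Fin m' → Fin k) → Matrix (Fin d) (Fin d) ℂ) :
    Submodule ℂ ((Fin m' → Fin k) → Matrix (Fin d) (Fin d) ℂ) where
  carrier := {Y | ∀ w, Y w = Q w * Y w * Q w}
  add_mem' := by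
    intro a b ha hb w
    simp only [Pi.add_apply]
    rw [Matrix.mul_add, Matrix.add_mul, ← ha w, ← hb w]
  zero_mem' := by intro w; simp
  smul_mem' := by
    intro c a ha w
    simp only [Pi.smul_apply]
    rw [Matrix.mul_smul, Matrix.smul_mul, ← ha w]

/-- The level-`m` empirical measure `P̂ₙ⁽ᵐ⁾ ∈ ℝ^{kᵐ}` of an output trajectory of length `n`
(with `m = m' + 1`, so the number of windows is `n - m + 1 = n - m'`). -/
noncomputable def empMeas {k m' : ℕ} (n : ℕ) (i : Fin n → Fin k) :
    (Fin (m' + 1) → Fin k) → ℝ :=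
  fun w => ((n - m' : ℕ) : ℝ)⁻¹ * ∑ j : Fin (n - m'),
    if (fun l : Fin (m' + 1) => i ⟨j.1 + l.1, by have hj := j.2; have hl := l.2; omega⟩) = w
    then 1 else 0

/-- The operator `T_{z,m}` with complex parameter `z`, as a linear map. -/
noncomputable def tiltedT {d k m' : ℕ} (V : Fin k → Matrix (Fin d) (Fin d) ℂ)
    (z : (Fin (m' + 1) → Fin k) → ℂ) :
    Module.End ℂ ((Fin m' → Fin k) → Matrix (Fin d) (Fin d) ℂ) where
  toFun Y := fun w => ∑ j : Fin k,
    Complex.exp (z (Fin.snoc w j)) •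
      ((V ((Fin.snoc w j : Fin (m' + 1) → Fin k) 0))ᴴ *
        Y (Fin.tail (Fin.snoc w j : Fin (m' + 1) → Fin k)) *
        V ((Fin.snoc w j : Fin (m' + 1) → Fin k) 0))
  map_add' Y Z := by
    funext w
    simp only [Pi.add_apply, Matrix.mul_add, Matrix.add_mul, smul_add, Finset.sum_add_distrib]
  map_smul' c Y := by
    funext w
    simp only [Pi.smul_apply, Matrix.mul_smul, Matrix.smul_mul, Finset.smul_sum, RingHom.id_apply]
    exact Finset.sum_congr rfl fun j _ => smul_comm _ _ _

/-- The sum of `z` over the `r` windows of length `m' + 1` of a word of length `m' + r`. -/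
noncomputable def windowSum {k m' : ℕ} (z : (Fin (m' + 1) → Fin k) → ℂ) (r : ℕ)
    (i : Fin (m' + r) → Fin k) : ℂ :=
  ∑ j : Fin r, z (fun l : Fin (m' + 1) => i ⟨j.1 + l.1, by omega⟩)

/-- The quadratic form `x ↦ ⟨x, A x⟩`. -/
noncomputable def qform {d : ℕ} (x : Fin d → ℂ) (A : Matrix (Fin d) (Fin d) ℂ) : ℂ :=
  star x ⬝ᵥ (A *ᵥ x)

section Basic

variable {d k m' : ℕ} (V : Fin k → Matrix (Fin d) (Fin d) ℂ)

lemma extT_eq_tiltedT (t : (Fin (m' + 1) → Fin k) → ℝ)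
    (Y : (Fin m' → Fin k) → Matrix (Fin d) (Fin d) ℂ) :
    extT V t Y = tiltedT V (fun v => (t v : ℂ)) Y := by
  funext w
  simp [extT, tiltedT]

lemma tiltedT_apply (z : (Fin (m' + 1) → Fin k) → ℂ)
    (Y : (Fin m' → Fin k) → Matrix (Fin d) (Fin d) ℂ) (w : Fin m' → Fin k) :
    tiltedT V z Y w = ∑ j : Fin k, Complex.exp (z (Fin.snoc w j)) •
      ((V ((Fin.snoc w j : Fin (m' + 1) → Fin k) 0))ᴴ *
        Y (Fin.tail (Fin.snoc w j : Fin (m' + 1) → Fin k)) *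
        V ((Fin.snoc w j : Fin (m' + 1) → Fin k) 0)) := rfl

lemma sum_words_snoc {M : Type*} [AddCommMonoid M] {n : ℕ} (f : (Fin (n + 1) → Fin k) → M) :
    ∑ i, f i = ∑ w : Fin n → Fin k, ∑ j : Fin k, f (Fin.snoc w j) := by
  rw [← (Fin.snocEquiv fun _ : Fin (n + 1) => Fin k).sum_comp, Fintype.sum_prod_type,
    Finset.sum_comm]
  rfl

lemma sum_words_cons {M : Type*} [AddCommMonoid M] {n : ℕ} (f : (Fin (n + 1) → Fin k) → M) :
    ∑ i, f i = ∑ j : Fin k, ∑ w : Fin n → Fin k, f (Fin.cons j w) := by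
  rw [← (Fin.consEquiv fun _ : Fin (n + 1) => Fin k).sum_comp, Fintype.sum_prod_type]
  rfl

lemma prodRev_zero (i : Fin 0 → Fin k) : prodRev V i = 1 := by
  simp [prodRev]

lemma prodRev_snoc {n : ℕ} (w : Fin n → Fin k) (j : Fin k) :
    prodRev V (Fin.snoc w j : Fin (n + 1) → Fin k) = V j * prodRev V w := by
  rw [prodRev, List.ofFn_succ']
  simp [prodRev]

lemma prodRev_eq_tail_mul {n : ℕ} (v : Fin (n + 1) → Fin k) :
    prodRev V v = prodRev V (Fin.tail v) * V (v 0) := by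
  rw [prodRev, List.ofFn_succ]
  simp [prodRev, Fin.tail_def]

lemma prodRev_split {a b n : ℕ} (h : a + b = n) (i : Fin n → Fin k) :
    prodRev V i = prodRev V (fun l : Fin b => i ⟨a + l.1, by omega⟩) *
      prodRev V (fun l : Fin a => i ⟨l.1, by omega⟩) := by
  subst h
  simp [prodRev, List.ofFn_add, Fin.natAdd, Fin.castLE]

lemma windowSum_snoc (z : (Fin (m' + 1) → Fin k) → ℂ) (r : ℕ)
    (i : Fin (m' + r) → Fin k) (c : Fin k) :
    windowSum z (r + 1) (Fin.snoc i c : Fin (m' + r + 1) → Fin k) =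
      windowSum z r i + z (Fin.snoc (fun l : Fin m' => i ⟨r + l.1, by omega⟩) c) := by
  unfold windowSum
  rw [Fin.sum_univ_castSucc]
  congr 1
  · refine Finset.sum_congr rfl fun j _ => congrArg z (funext fun l => ?_)
    have : j.1 + l.1 < m' + r := by omega
    simp [Fin.snoc, this]
  · refine congrArg z (funext fun l => ?_)
    refine Fin.lastCases ?_ (fun l => ?_) l
    · simp [Fin.snoc, add_comm]
    · have : r + l.1 < m' + r := by omega
      simp [Fin.snoc, this]

/-- Expansion of the powers of the tilted operator as a sum over trajectories. -/
lemma sum_smul_tiltedT_pow (g : (Fin m' → Fin k) → ℂ) (z : (Fin (m' + 1) → Fin k) → ℂ) (r : ℕ)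
    (Y : (Fin m' → Fin k) → Matrix (Fin d) (Fin d) ℂ) :
    ∑ w, g w • (tiltedT V z ^ r) Y w =
      ∑ i : Fin (m' + r) → Fin k,
        (g (fun l => i ⟨l.1, by omega⟩) * Complex.exp (windowSum z r i)) •
          ((prodRev V (fun l : Fin r => i ⟨l.1, by omega⟩))ᴴ *
            Y (fun l => i ⟨r + l.1, by omega⟩) *
            prodRev V (fun l : Fin r => i ⟨l.1, by omega⟩)) := by
  induction r generalizing Y with
  | zero => simp [prodRev_zero, windowSum]
  | succ r ih =>
    simp only [pow_succ, Module.End.mul_apply]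
    rw [ih]
    refine Eq.trans ?_ (sum_words_snoc (n := m' + r) _).symm
    refine Finset.sum_congr rfl fun i _ => ?_
    rw [tiltedT_apply, Finset.mul_sum, Finset.sum_mul, Finset.smul_sum]
    refine Finset.sum_congr rfl fun c _ => ?_
    rw [windowSum_snoc, Complex.exp_add]
    have h1 : (fun l : Fin m' => (Fin.snoc i c : Fin (m' + r + 1) → Fin k) ⟨l.1, by omega⟩) =
        fun l => i ⟨l.1, by omega⟩ := by
      funext l
      have : l.1 < m' + r := by omega
      simp [Fin.snoc, this]
    have h2 : (fun l : Fin m' => (Fin.snoc i c : Fin (m' + r + 1) → Fin k)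
        ⟨r + 1 + l.1, by omega⟩) = Fin.tail
          (Fin.snoc (fun l : Fin m' => i ⟨r + l.1, by omega⟩) c : Fin (m' + 1) → Fin k) := by
      funext l
      by_cases hl : l.1 + 1 < m'
      · have : r + 1 + l.1 < m' + r := by omega
        simp [Fin.snoc, Fin.tail, this, hl]
        congr 2
        omega
      · have : ¬ r + 1 + l.1 < m' + r := by omega
        simp [Fin.snoc, Fin.tail, this, hl]
    have h3 : prodRev V (fun l : Fin (r + 1) => (Fin.snoc i c : Fin (m' + r + 1) → Fin k)
        ⟨l.1, by omega⟩) = V ((Fin.snoc (fun l : Fin m' => i ⟨r + l.1, by omega⟩) c :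
          Fin (m' + 1) → Fin k) 0) * prodRev V (fun l : Fin r => i ⟨l.1, by omega⟩) := by
      rw [← prodRev_snoc]
      congr 1
      funext l
      refine Fin.lastCases ?_ (fun l => ?_) l
      · by_cases hm : 0 < m' <;> simp [Fin.snoc, hm]
      · have : l.1 < m' + r := by omega
        simp [Fin.snoc, this]
    rw [h1, h2, h3]
    simp only [Matrix.conjTranspose_mul, Matrix.mul_smul, Matrix.smul_mul, smul_smul,
      mul_assoc]

end Basic

section QuadraticForm

variable {d k m' : ℕ} (V : Fin k → Matrix (Fin d) (Fin d) ℂ)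

lemma qform_add (x : Fin d → ℂ) (A B : Matrix (Fin d) (Fin d) ℂ) :
    qform x (A + B) = qform x A + qform x B := by
  simp [qform, Matrix.add_mulVec]

lemma qform_sub (x : Fin d → ℂ) (A B : Matrix (Fin d) (Fin d) ℂ) :
    qform x (A - B) = qform x A - qform x B := by
  simp [qform, Matrix.sub_mulVec]

lemma qform_smul (x : Fin d → ℂ) (c : ℂ) (A : Matrix (Fin d) (Fin d) ℂ) :
    qform x (c • A) = c * qform x A := by
  simp [qform, Matrix.smul_mulVec]

lemma qform_sum {ι : Type*} (s : Finset ι) (x : Fin d → ℂ)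
    (A : ι → Matrix (Fin d) (Fin d) ℂ) :
    qform x (∑ i ∈ s, A i) = ∑ i ∈ s, qform x (A i) := by
  simp [qform, Matrix.sum_mulVec, dotProduct_sum]

lemma qform_conjTranspose_mul_mul (x : Fin d → ℂ) (A B : Matrix (Fin d) (Fin d) ℂ) :
    qform x (Bᴴ * A * B) = qform (B *ᵥ x) A := by
  simp [qform, Matrix.star_mulVec, Matrix.dotProduct_mulVec, Matrix.vecMul_vecMul,
    Matrix.mul_assoc]

lemma qform_conjTranspose (x : Fin d → ℂ) (A : Matrix (Fin d) (Fin d) ℂ) :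
    qform x Aᴴ = star (qform x A) := by
  rw [qform, qform, ← star_dotProduct, Matrix.star_mulVec, Matrix.dotProduct_mulVec]

lemma qform_one (x : Fin d → ℂ) : qform x 1 = ((∑ a, ‖x a‖ ^ 2 : ℝ) : ℂ) := by
  simp [qform, dotProduct, Complex.conj_mul']

lemma norm_qform_le {A : Matrix (Fin d) (Fin d) ℂ} {ε : ℝ} (hA : ∀ a b, ‖A a b‖ ≤ ε)
    (x : Fin d → ℂ) : ‖qform x A‖ ≤ ε * d * (qform x 1).re := by
  have h1 : ‖qform x A‖ ≤ ∑ a, ∑ b, ε * (‖x a‖ * ‖x b‖) := by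
    simp only [qform, dotProduct, Matrix.mulVec, Finset.mul_sum]
    refine (norm_sum_le _ _).trans (Finset.sum_le_sum fun a _ => ?_)
    refine (norm_sum_le _ _).trans (Finset.sum_le_sum fun b _ => ?_)
    simp only [norm_mul, Pi.star_apply, norm_star]
    nlinarith [mul_le_mul_of_nonneg_right (hA a b)
      (mul_nonneg (norm_nonneg (x a)) (norm_nonneg (x b)))]
  have h2 : ∑ a, ∑ b, ε * (‖x a‖ * ‖x b‖) = ε * (∑ a, ‖x a‖) ^ 2 := by
    rw [sq, Finset.sum_mul_sum, Finset.mul_sum]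
    simp only [Finset.mul_sum]
  rw [h2] at h1
  have h3 : (∑ a, ‖x a‖) ^ 2 ≤ d * ∑ a, ‖x a‖ ^ 2 := by
    simpa using sq_sum_le_card_mul_sum_sq (s := Finset.univ) (f := fun a => ‖x a‖)
  rcases isEmpty_or_nonempty (Fin d) with hd | ⟨⟨a⟩⟩
  · simp [qform]
  · have hε : 0 ≤ ε := (norm_nonneg _).trans (hA a a)
    rw [qform_one, Complex.ofReal_re, mul_assoc]
    exact h1.trans (mul_le_mul_of_nonneg_left h3 hε)

lemma eq_zero_of_qform_eq_zero {A : Matrix (Fin d) (Fin d) ℂ} (h : ∀ x, qform x A = 0) :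
    A = 0 := by
  have h1 := (inner_map_self_eq_zero (Matrix.toEuclideanLin A)).1 fun x => by
    have h2 := h x.ofLp
    rw [← inner_conj_symm, EuclideanSpace.inner_eq_star_dotProduct,
      Matrix.ofLp_toLpLin, Matrix.toLin'_apply, dotProduct_comm]
    simpa [qform] using h2
  simpa using h1

lemma norm_qform_tiltedT_le {Z Y : (Fin m' → Fin k) → Matrix (Fin d) (Fin d) ℂ}
    {z : (Fin (m' + 1) → Fin k) → ℂ} {t : (Fin (m' + 1) → Fin k) → ℝ}
    (hz : ∀ v, (z v).re = t v) (h : ∀ w x, ‖qform x (Z w)‖ ≤ (qform x (Y w)).re)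
    (w : Fin m' → Fin k) (x : Fin d → ℂ) :
    ‖qform x (tiltedT V z Z w)‖ ≤ (qform x (tiltedT V (fun v => (t v : ℂ)) Y w)).re := by
  simp only [tiltedT_apply, qform_sum, qform_smul, qform_conjTranspose_mul_mul, Complex.re_sum]
  refine (norm_sum_le _ _).trans (Finset.sum_le_sum fun j _ => ?_)
  rw [norm_mul, Complex.norm_exp, hz, ← Complex.ofReal_exp, Complex.re_ofReal_mul]
  exact mul_le_mul_of_nonneg_left (h _ _) (Real.exp_pos _).le

lemma norm_qform_tiltedT_pow_le {Z Y : (Fin m' → Fin k) → Matrix (Fin d) (Fin d) ℂ}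
    {z : (Fin (m' + 1) → Fin k) → ℂ} {t : (Fin (m' + 1) → Fin k) → ℝ}
    (hz : ∀ v, (z v).re = t v) (h : ∀ w x, ‖qform x (Z w)‖ ≤ (qform x (Y w)).re) (r : ℕ)
    (w : Fin m' → Fin k) (x : Fin d → ℂ) :
    ‖qform x ((tiltedT V z ^ r) Z w)‖ ≤
      (qform x ((tiltedT V (fun v => (t v : ℂ)) ^ r) Y w)).re := by
  induction r generalizing w x with
  | zero => exact h w x
  | succ r ih =>
    simp only [pow_succ', Module.End.mul_apply]
    exact norm_qform_tiltedT_le V hz ih w x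

lemma tiltedT_conjTranspose (z : (Fin (m' + 1) → Fin k) → ℂ)
    (Y : (Fin m' → Fin k) → Matrix (Fin d) (Fin d) ℂ) (w : Fin m' → Fin k) :
    (tiltedT V z Y w)ᴴ = tiltedT V (fun v => star (z v)) (fun w => (Y w)ᴴ) w := by
  simp [tiltedT_apply, Matrix.conjTranspose_sum, ← Complex.exp_conj, Matrix.mul_assoc]

lemma tiltedT_zero_Mmat (hnorm : ∑ i : Fin k, (V i)ᴴ * V i = 1) :
    tiltedT V 0 (Mmat (m' := m') V) = Mmat V := by
  funext w
  have h : ∀ j : Fin k, (V ((Fin.snoc w j : Fin (m' + 1) → Fin k) 0))ᴴ *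
        Mmat V (Fin.tail (Fin.snoc w j : Fin (m' + 1) → Fin k)) *
        V ((Fin.snoc w j : Fin (m' + 1) → Fin k) 0) =
      (prodRev V w)ᴴ * ((V j)ᴴ * V j) * prodRev V w := by
    intro j
    have := prodRev_snoc V w j
    rw [prodRev_eq_tail_mul] at this
    calc _ = (prodRev V (Fin.tail (Fin.snoc w j : Fin (m' + 1) → Fin k)) *
              V ((Fin.snoc w j : Fin (m' + 1) → Fin k) 0))ᴴ *
            (prodRev V (Fin.tail (Fin.snoc w j : Fin (m' + 1) → Fin k)) *
              V ((Fin.snoc w j : Fin (m' + 1) → Fin k) 0)) := by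
          simp only [Mmat, Matrix.conjTranspose_mul, Matrix.mul_assoc]
      _ = _ := by
          rw [this]
          simp only [Matrix.conjTranspose_mul, Matrix.mul_assoc]
  simp only [tiltedT_apply, Pi.zero_apply, Complex.exp_zero, one_smul, h]
  rw [← Finset.sum_mul, ← Finset.mul_sum, hnorm, Matrix.mul_one, Mmat]

lemma sum_tiltedT_zero (Y : (Fin m' → Fin k) → Matrix (Fin d) (Fin d) ℂ) :
    ∑ w, tiltedT V 0 Y w = Tmap V (∑ w, Y w) := by
  simp only [tiltedT_apply, Pi.zero_apply, Complex.exp_zero, one_smul, Tmap]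
  rw [← sum_words_snoc (fun v : Fin (m' + 1) → Fin k => (V (v 0))ᴴ * Y (Fin.tail v) * V (v 0)),
    sum_words_cons]
  simp [Finset.mul_sum, Finset.sum_mul]

lemma sum_tiltedT_zero_pow (r : ℕ) (Y : (Fin m' → Fin k) → Matrix (Fin d) (Fin d) ℂ) :
    ∑ w, (tiltedT V 0 ^ r) Y w = (Tmap V)^[r] (∑ w, Y w) := by
  induction r with
  | zero => simp
  | succ r ih =>
    simp only [pow_succ', Module.End.mul_apply, sum_tiltedT_zero, ih, Function.iterate_succ_apply']

lemma Tmap_smul_one (hnorm : ∑ i : Fin k, (V i)ᴴ * V i = 1) (c : ℂ) :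
    Tmap V (c • 1) = c • 1 := by
  simp [Tmap, ← Finset.smul_sum, hnorm]

/-- Sums of quadratic forms of iterates are bounded uniformly in the number of iterations when the
tilting parameter is purely imaginary. -/
lemma norm_sum_qform_tiltedT_pow_le (hnorm : ∑ i : Fin k, (V i)ᴴ * V i = 1)
    {z : (Fin (m' + 1) → Fin k) → ℂ} (hz : ∀ v, (z v).re = 0)
    {Y : (Fin m' → Fin k) → Matrix (Fin d) (Fin d) ℂ} {ε : ℝ} (hY : ∀ w a b, ‖Y w a b‖ ≤ ε)
    (r : ℕ) (x : Fin d → ℂ) :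
    ‖∑ w, qform x ((tiltedT V z ^ r) Y w)‖ ≤ ε * d * (k : ℝ) ^ m' * (qform x 1).re := by
  have h := norm_qform_tiltedT_pow_le V (Z := Y) (t := 0) hz
    (Y := fun _ => ((ε * d : ℝ) : ℂ) • 1) (fun w x => by
      rw [qform_smul, Complex.re_ofReal_mul]
      exact norm_qform_le (hY w) x) r
  refine (norm_sum_le _ _).trans ((Finset.sum_le_sum fun w _ => h w x).trans ?_)
  have h0 : (fun v : Fin (m' + 1) → Fin k => (((0 : (Fin (m' + 1) → Fin k) → ℝ) v : ℝ) : ℂ)) =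
      0 := by
    funext v; simp
  rw [← Complex.re_sum, ← qform_sum, h0, sum_tiltedT_zero_pow]
  have hfix : ∀ c : ℂ, (Tmap V)^[r] (c • 1) = c • 1 := fun c =>
    Function.iterate_fixed (Tmap_smul_one V hnorm c) r
  have hs : ∑ _w : Fin m' → Fin k, ((ε * d : ℝ) : ℂ) • (1 : Matrix (Fin d) (Fin d) ℂ) =
      ((ε * d * (k : ℝ) ^ m' : ℝ) : ℂ) • 1 := by
    rw [Finset.sum_const, ← Nat.cast_smul_eq_nsmul ℂ, smul_smul]
    congr 1
    simp
    ring
  rw [hs, hfix, qform_smul, Complex.re_ofReal_mul]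

/-- A fixed point of a primitive unital transition operator is a scalar matrix (Hermitian case). -/
lemma exists_eq_smul_one_of_isHermitian (hd : 1 ≤ d) (hnorm : ∑ i : Fin k, (V i)ᴴ * V i = 1)
    (hprim : ∃ n : ℕ, ∀ A : Matrix (Fin d) (Fin d) ℂ,
      A.PosSemidef → A ≠ 0 → ((Tmap V)^[n] A).PosDef)
    {A : Matrix (Fin d) (Fin d) ℂ} (hA : A.IsHermitian) (hfix : Tmap V A = A) :
    ∃ c : ℂ, A = c • 1 := by
  have : Nonempty (Fin d) := ⟨⟨0, hd⟩⟩
  obtain ⟨i₀, hi₀⟩ := Finite.exists_min hA.eigenvalues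
  set c : ℂ := (hA.eigenvalues i₀ : ℂ) with hc
  have hpos : (A - c • 1).PosSemidef := by
    have h1 : A - c • 1 = (hA.eigenvectorUnitary : Matrix (Fin d) (Fin d) ℂ) *
        diagonal (fun i => ((hA.eigenvalues i - hA.eigenvalues i₀ : ℝ) : ℂ)) *
        (hA.eigenvectorUnitary : Matrix (Fin d) (Fin d) ℂ)ᴴ := by
      have h2 := hA.spectral_theorem
      rw [Unitary.conjStarAlgAut_apply] at h2
      have h3 : diagonal (fun i => ((hA.eigenvalues i - hA.eigenvalues i₀ : ℝ) : ℂ)) =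
          diagonal (RCLike.ofReal ∘ hA.eigenvalues) - c • (1 : Matrix (Fin d) (Fin d) ℂ) := by
        rw [Matrix.smul_one_eq_diagonal, Matrix.diagonal_sub]
        congr 1
        funext i
        simp [hc]
      rw [h3, Matrix.mul_sub, Matrix.sub_mul, ← Matrix.star_eq_conjTranspose, ← h2]
      simp
    rw [h1]
    refine PosSemidef.mul_mul_conjTranspose_same (posSemidef_diagonal_iff.2 fun i => ?_) _
    exact Complex.zero_le_real.2 (sub_nonneg.2 (hi₀ i))
  refine ⟨c, ?_⟩
  by_contra hne
  obtain ⟨n, hn⟩ := hprim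
  have hfix' : Tmap V (A - c • 1) = A - c • 1 := by
    have h := Tmap_smul_one V hnorm c
    unfold Tmap at h hfix ⊢
    simp only [Matrix.mul_sub, Matrix.sub_mul, Finset.sum_sub_distrib, h, hfix]
  have hpd := hn _ hpos (sub_ne_zero.2 hne)
  rw [Function.iterate_fixed hfix'] at hpd
  have hv : (hA.eigenvectorBasis i₀).ofLp ≠ 0 := by
    intro h
    exact hA.eigenvectorBasis.orthonormal.ne_zero i₀ (by ext i; simp [h])
  have := hpd.dotProduct_mulVec_pos hv
  rw [Matrix.sub_mulVec, hA.mulVec_eigenvectorBasis] at this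
  simp [hc, Matrix.smul_mulVec] at this

lemma exists_eq_smul_one_of_Tmap_eq (hd : 1 ≤ d) (hnorm : ∑ i : Fin k, (V i)ᴴ * V i = 1)
    (hprim : ∃ n : ℕ, ∀ A : Matrix (Fin d) (Fin d) ℂ,
      A.PosSemidef → A ≠ 0 → ((Tmap V)^[n] A).PosDef)
    {A : Matrix (Fin d) (Fin d) ℂ} (hfix : Tmap V A = A) : ∃ c : ℂ, A = c • 1 := by
  have hstar : Tmap V Aᴴ = Aᴴ := by
    conv_rhs => rw [← hfix]
    simp [Tmap, Matrix.conjTranspose_sum, Matrix.mul_assoc]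
  have hadd : ∀ B C : Matrix (Fin d) (Fin d) ℂ, ∀ b c : ℂ, Tmap V B = B → Tmap V C = C →
      Tmap V (b • B + c • C) = b • B + c • C := by
    intro B C b c hB hC
    unfold Tmap at *
    simp only [Matrix.mul_add, Matrix.add_mul, Matrix.mul_smul, Matrix.smul_mul,
      Finset.sum_add_distrib, ← Finset.smul_sum, hB, hC]
  obtain ⟨a, ha⟩ := exists_eq_smul_one_of_isHermitian V hd hnorm hprim
    (A := (1 : ℂ) • A + (1 : ℂ) • Aᴴ) (by simp [Matrix.IsHermitian, add_comm])
    (hadd _ _ _ _ hfix hstar)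
  obtain ⟨b, hb⟩ := exists_eq_smul_one_of_isHermitian V hd hnorm hprim
    (A := Complex.I • A + (-Complex.I) • Aᴴ) (by
      simp [Matrix.IsHermitian, add_comm])
    (hadd _ _ _ _ hfix hstar)
  refine ⟨(1 / 2 : ℂ) * a - (Complex.I / 2) * b, ?_⟩
  rw [sub_smul, mul_smul, mul_smul, ← ha, ← hb]
  ext i j
  simp
  linear_combination ((A i j) / 2 - (starRingEnd ℂ) (A j i) / 2) * Complex.I_sq

end QuadraticForm

section AbstractPerturbation

open scoped ContDiff Topology

/-- Analytic perturbation of a simple eigenvalue. -/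
theorem exists_analytic_eigenpair {P E : Type*} [NormedAddCommGroup P] [NormedSpace ℂ P]
    [CompleteSpace P] [NormedAddCommGroup E] [NormedSpace ℂ E] [FiniteDimensional ℂ E]
    (A : P → Module.End ℂ E) (hA : ContDiff ℂ ω fun q : P × E => A q.1 q.2)
    (e : E) (ℓ : E →ₗ[ℂ] ℂ) (he : A 0 e = e) (hℓ : ℓ e = 1)
    (hinj : ∀ (y : E) (c : ℂ), A 0 y - y = c • e → ℓ y = 0 → y = 0 ∧ c = 0) :
    ∃ (Y : P → E) (lam : P → ℂ), ContDiffAt ℂ ω lam 0 ∧ ContinuousAt Y 0 ∧ Y 0 = e ∧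
      lam 0 = 1 ∧ (∀ᶠ z in 𝓝 0, A z (Y z) = lam z • Y z ∧ ℓ (Y z) = 1) ∧
      ∀ᶠ q : P × E × ℂ in 𝓝 (0, e, 1),
        A q.1 q.2.1 = q.2.2 • q.2.1 → ℓ q.2.1 = 1 → Y q.1 = q.2.1 ∧ lam q.1 = q.2.2 := by
  have : CompleteSpace E := FiniteDimensional.complete ℂ E
  set ℓc : E →L[ℂ] ℂ := LinearMap.toContinuousLinearMap ℓ with hℓc
  set G : P × E × ℂ → E × ℂ := fun q => (A q.1 q.2.1 - q.2.2 • q.2.1, ℓc q.2.1 - 1) with hG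
  have hGd : ContDiff ℂ ω G := by
    refine ContDiff.prodMk (ContDiff.sub ?_ ?_) ?_
    · exact hA.comp (contDiff_fst.prodMk (contDiff_fst.comp contDiff_snd))
    · fun_prop
    · fun_prop
  set u : P × E × ℂ := (0, e, 1) with hu
  have hGu : G u = 0 := by simp [hG, hu, hℓc, he, hℓ]
  have hcd : ContDiffAt ℂ ω G u := hGd.contDiffAt
  have hderiv : ∀ v : E × ℂ, (fderiv ℂ G u ∘L .inr ℂ P (E × ℂ)) v =
      (A 0 v.1 - v.1 - v.2 • e, ℓ v.1) := by
    intro v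
    have h1 : HasFDerivAt (fun v : E × ℂ => G (0, v))
        (fderiv ℂ G u ∘L .inr ℂ P (E × ℂ)) (e, 1) := by
      have h2 : HasFDerivAt G (fderiv ℂ G u) ((0 : P), ((e, 1) : E × ℂ)) :=
        (hcd.differentiableAt (by simp)).hasFDerivAt
      exact h2.comp (e, (1 : ℂ)) (hasFDerivAt_prodMk_right (0 : P) ((e, 1) : E × ℂ))
    have h3 : HasFDerivAt (fun v : E × ℂ => G (0, v))
        (((LinearMap.toContinuousLinearMap (A 0) ∘L .fst ℂ E ℂ) -
          ((1 : ℂ) • ContinuousLinearMap.fst ℂ E ℂ +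
            (ContinuousLinearMap.snd ℂ E ℂ).smulRight e)).prod (ℓc ∘L .fst ℂ E ℂ)) (e, 1) := by
      refine HasFDerivAt.prodMk (HasFDerivAt.sub ?_ ?_) ?_
      · exact (LinearMap.toContinuousLinearMap (A 0) ∘L .fst ℂ E ℂ).hasFDerivAt
      · exact HasFDerivAt.smul (hasFDerivAt_snd (𝕜 := ℂ) (p := ((e, 1) : E × ℂ)))
          (hasFDerivAt_fst (𝕜 := ℂ) (p := ((e, 1) : E × ℂ)))
      · exact (ℓc ∘L .fst ℂ E ℂ).hasFDerivAt.sub_const 1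
    rw [h1.unique h3]
    simp [hℓc, sub_sub]
  have hinv : (fderiv ℂ G u ∘L .inr ℂ P (E × ℂ)).IsInvertible := by
    have hi : Function.Injective (fderiv ℂ G u ∘L .inr ℂ P (E × ℂ)) := by
      rw [injective_iff_map_eq_zero]
      intro v hv
      rw [hderiv, Prod.mk_eq_zero, sub_eq_zero] at hv
      obtain ⟨h1, h2⟩ := hinj _ _ hv.1 hv.2
      exact Prod.ext h1 h2
    exact ⟨ContinuousLinearEquiv.ofBijective _ (LinearMap.ker_eq_bot.2 hi)
      (LinearMap.range_eq_top.2 (LinearMap.injective_iff_surjective.1 hi)), rfl⟩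
  have hω : (ω : WithTop ℕ∞) ≠ 0 := by simp
  set Φ := hcd.implicitFunction hω hinv with hΦ
  have hΦd : ContDiffAt ℂ ω Φ 0 := hcd.contDiffAt_implicitFunction hω hinv
  have hΦ0 : Φ 0 = (e, 1) := hcd.implicitFunction_apply_self hω hinv
  refine ⟨fun z => (Φ z).1, fun z => (Φ z).2, contDiff_snd.contDiffAt.comp 0 hΦd,
    (continuous_fst.continuousAt.comp hΦd.continuousAt), by simp [hΦ0], by simp [hΦ0], ?_, ?_⟩
  · filter_upwards [hcd.eventually_apply_implicitFunction hω hinv] with z hz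
    rw [hGu] at hz
    have := Prod.mk_eq_zero.1 hz
    exact ⟨sub_eq_zero.1 this.1, sub_eq_zero.1 this.2⟩
  · filter_upwards [hcd.eventually_apply_eq_iff_implicitFunction hω hinv] with q hq h1 h2
    have h3 : G q = G u := by
      rw [hGu]
      exact Prod.mk_eq_zero.2 ⟨sub_eq_zero.2 h1, sub_eq_zero.2 h2⟩
    have h4 := hq.1 h3
    exact ⟨congrArg Prod.fst h4, congrArg Prod.snd h4⟩

end AbstractPerturbation

section TiltedOperator

open scoped ContDiff Topology

attribute [local instance] Matrix.normedAddCommGroup Matrix.normedSpace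

variable {d k m' : ℕ} (V : Fin k → Matrix (Fin d) (Fin d) ℂ)

/-- The middle factor of the `m'`-th power of the tilted operator. -/
noncomputable def tailSum {d k m' : ℕ} (z : (Fin (m' + 1) → Fin k) → ℂ)
    (Y : (Fin m' → Fin k) → Matrix (Fin d) (Fin d) ℂ) :
    (Fin m' → Fin k) → Matrix (Fin d) (Fin d) ℂ :=
  fun w => ∑ b : Fin m' → Fin k, Complex.exp (windowSum z m' (Fin.append w b)) • Y b

lemma tiltedT_pow_eq (z : (Fin (m' + 1) → Fin k) → ℂ)
    (Y : (Fin m' → Fin k) → Matrix (Fin d) (Fin d) ℂ) (w : Fin m' → Fin k) :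
    (tiltedT V z ^ m') Y w = (prodRev V w)ᴴ * tailSum z Y w * prodRev V w := by
  have h := sum_smul_tiltedT_pow V (fun w' => if w' = w then 1 else 0) z m' Y
  simp only [ite_smul, one_smul, zero_smul, Finset.sum_ite_eq', Finset.mem_univ, if_true] at h
  rw [h, ← (Fin.appendEquiv m' m').sum_comp, Fintype.sum_prod_type, Finset.sum_eq_single w]
  · simp only [tailSum, Finset.mul_sum, Finset.sum_mul]
    refine Finset.sum_congr rfl fun b _ => ?_
    have h1 : (fun l : Fin m' => Fin.appendEquiv m' m' (w, b) ⟨l.1, by omega⟩) = w :=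
      funext fun l => Fin.append_left w b l
    have h2 : (fun l : Fin m' => Fin.appendEquiv m' m' (w, b) ⟨m' + l.1, by omega⟩) = b :=
      funext fun l => Fin.append_right w b l
    rw [h1, h2]
    simp [Fin.appendEquiv]
  · intro w' _ hw'
    refine Finset.sum_eq_zero fun b _ => ?_
    have h1 : (fun l : Fin m' => Fin.appendEquiv m' m' (w', b) ⟨l.1, by omega⟩) = w' :=
      funext fun l => Fin.append_left w' b l
    rw [h1, if_neg hw']
    simp
  · simp

lemma tailSum_zero (Y : (Fin m' → Fin k) → Matrix (Fin d) (Fin d) ℂ) (w : Fin m' → Fin k) :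
    tailSum 0 Y w = ∑ b, Y b := by
  simp [tailSum, windowSum]

lemma sum_Mmat (hnorm : ∑ i : Fin k, (V i)ᴴ * V i = 1) :
    ∑ w, Mmat (m' := m') V w = 1 := by
  induction m' with
  | zero => simp [Mmat, prodRev_zero]
  | succ n ih =>
    rw [sum_words_snoc, ← ih]
    refine Finset.sum_congr rfl fun w _ => ?_
    have : ∀ j, Mmat V (Fin.snoc w j : Fin (n + 1) → Fin k) =
        (prodRev V w)ᴴ * ((V j)ᴴ * V j) * prodRev V w := fun j => by
      simp only [Mmat, prodRev_snoc, Matrix.conjTranspose_mul, Matrix.mul_assoc]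
    simp only [this]
    rw [← Finset.sum_mul, ← Finset.mul_sum, hnorm, Matrix.mul_one, Mmat]

lemma norm_entry_le_norm (Y : (Fin m' → Fin k) → Matrix (Fin d) (Fin d) ℂ)
    (w : Fin m' → Fin k) (a b : Fin d) : ‖Y w a b‖ ≤ ‖Y‖ :=
  (Matrix.norm_entry_le_entrywise_sup_norm _).trans (norm_le_pi_norm Y w)

/-- The linear functional `Y ↦ ∑ w, ⟨ψ, Y_w ψ⟩`. -/
noncomputable def stateFunctional {d k m' : ℕ} (ψ : Fin d → ℂ) :
    ((Fin m' → Fin k) → Matrix (Fin d) (Fin d) ℂ) →ₗ[ℂ] ℂ where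
  toFun Y := ∑ w, qform ψ (Y w)
  map_add' Y Z := by simp [qform_add, Finset.sum_add_distrib]
  map_smul' c Y := by simp [qform_smul, Finset.mul_sum]

lemma stateFunctional_apply (ψ : Fin d → ℂ)
    (Y : (Fin m' → Fin k) → Matrix (Fin d) (Fin d) ℂ) :
    stateFunctional ψ Y = ∑ w, qform ψ (Y w) := rfl

lemma stateFunctional_Mmat (hnorm : ∑ i : Fin k, (V i)ᴴ * V i = 1) {ψ : Fin d → ℂ}
    (hψ : ∑ x : Fin d, ‖ψ x‖ ^ 2 = 1) :
    stateFunctional ψ (Mmat (m' := m') V) = 1 := by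
  rw [stateFunctional_apply, ← qform_sum, sum_Mmat V hnorm, qform_one, hψ, Complex.ofReal_one]

lemma norm_stateFunctional_pow_le (hnorm : ∑ i : Fin k, (V i)ᴴ * V i = 1) {ψ : Fin d → ℂ}
    (hψ : ∑ x : Fin d, ‖ψ x‖ ^ 2 = 1) {z : (Fin (m' + 1) → Fin k) → ℂ}
    (hz : ∀ v, (z v).re = 0) (Y : (Fin m' → Fin k) → Matrix (Fin d) (Fin d) ℂ) (r : ℕ) :
    ‖stateFunctional ψ ((tiltedT V z ^ r) Y)‖ ≤ ‖Y‖ * d * (k : ℝ) ^ m' := by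
  have := norm_sum_qform_tiltedT_pow_le V hnorm hz (norm_entry_le_norm Y) r ψ
  rwa [qform_one, hψ, Complex.ofReal_one, Complex.one_re, mul_one] at this

/-- The eigenvalue `1` of the untilted operator is simple. -/
lemma tiltedT_zero_simple (hd : 1 ≤ d) (hnorm : ∑ i : Fin k, (V i)ᴴ * V i = 1)
    (hprim : ∃ n : ℕ, ∀ A : Matrix (Fin d) (Fin d) ℂ,
      A.PosSemidef → A ≠ 0 → ((Tmap V)^[n] A).PosDef) {ψ : Fin d → ℂ}
    (hψ : ∑ x : Fin d, ‖ψ x‖ ^ 2 = 1) (y : (Fin m' → Fin k) → Matrix (Fin d) (Fin d) ℂ)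
    (c : ℂ) (hy : tiltedT V 0 y - y = c • Mmat V) (hℓ : stateFunctional ψ y = 0) :
    y = 0 ∧ c = 0 := by
  have hM : tiltedT V 0 (Mmat (m' := m') V) = Mmat V := tiltedT_zero_Mmat V hnorm
  have hpow : ∀ r : ℕ, (tiltedT V 0 ^ r) y = y + ((r : ℂ) * c) • Mmat V := by
    intro r
    induction r with
    | zero => simp
    | succ r ih =>
      rw [pow_succ', Module.End.mul_apply, ih, map_add, map_smul, hM, sub_eq_iff_eq_add.1 hy]
      push_cast
      module
  have hc : c = 0 := by
    by_contra hc
    obtain ⟨r, hr⟩ := exists_nat_gt (‖y‖ * d * (k : ℝ) ^ m' / ‖c‖)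
    have h1 := norm_stateFunctional_pow_le V hnorm hψ (z := 0) (fun _ => by simp) y r
    rw [hpow, map_add, hℓ, map_smul, stateFunctional_Mmat V hnorm hψ] at h1
    rw [div_lt_iff₀ (norm_pos_iff.2 hc)] at hr
    simp at h1
    linarith
  refine ⟨?_, hc⟩
  rw [hc, zero_smul, sub_eq_zero] at hy
  have hsum : Tmap V (∑ w, y w) = ∑ w, y w := by rw [← sum_tiltedT_zero, hy]
  obtain ⟨a, ha⟩ := exists_eq_smul_one_of_Tmap_eq V hd hnorm hprim hsum
  have hy2 : y = a • Mmat V := by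
    funext w
    have h1 := tiltedT_pow_eq V 0 y w
    rw [hpow, hc, tailSum_zero, ha] at h1
    simpa [Mmat] using h1
  rw [hy2, map_smul, stateFunctional_Mmat V hnorm hψ, smul_eq_mul, mul_one] at hℓ
  rw [hy2, hℓ, zero_smul]

/-- Every eigenvalue is dominated by an eigenvalue with a positive eigenvector. -/
lemma norm_eigenvalue_le {t : (Fin (m' + 1) → Fin k) → ℝ} {lam : ℝ} (hlam : 0 < lam)
    {Y : (Fin m' → Fin k) → Matrix (Fin d) (Fin d) ℂ}
    (hY : tiltedT V (fun v => (t v : ℂ)) Y = (lam : ℂ) • Y)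
    (hpos : ∀ w x, (qform (prodRev V w *ᵥ x) 1).re ≤ 2 * (qform x (Y w)).re)
    {Z : (Fin m' → Fin k) → Matrix (Fin d) (Fin d) ℂ} (hZ0 : Z ≠ 0) {μ : ℂ}
    (hZ : tiltedT V (fun v => (t v : ℂ)) Z = μ • Z) : ‖μ‖ ≤ lam := by
  rcases eq_or_ne μ 0 with rfl | hμ
  · simpa using hlam.le
  have hpow : ∀ (c : ℂ) (X : (Fin m' → Fin k) → Matrix (Fin d) (Fin d) ℂ),
      tiltedT V (fun v => (t v : ℂ)) X = c • X →
      ∀ r : ℕ, (tiltedT V (fun v => (t v : ℂ)) ^ r) X = c ^ r • X := by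
    intro c X hX r
    induction r with
    | zero => simp
    | succ r ih => rw [pow_succ', Module.End.mul_apply, ih, map_smul, hX, smul_smul, pow_succ]
  set N : ℝ := ‖tailSum (fun v => (t v : ℂ)) Z‖ * d with hN
  set C : ℝ := 2 * N / ‖μ‖ ^ m' with hC
  have hμpos : 0 < ‖μ‖ ^ m' := pow_pos (norm_pos_iff.2 hμ) _
  have hdom : ∀ w x, ‖qform x (Z w)‖ ≤ (qform x (((C : ℂ) • Y) w)).re := by
    intro w x
    have h1 := congrFun (hpow μ Z hZ m') w
    rw [tiltedT_pow_eq] at h1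
    have h2 := congrArg (fun A => ‖qform x A‖) h1
    simp only [qform_conjTranspose_mul_mul, Pi.smul_apply, qform_smul, norm_mul, norm_pow] at h2
    have h3 := norm_qform_le (norm_entry_le_norm (tailSum (fun v => (t v : ℂ)) Z) w)
      (prodRev V w *ᵥ x)
    rw [h2] at h3
    have h4 : N * (qform (prodRev V w *ᵥ x) 1).re ≤ N * (2 * (qform x (Y w)).re) :=
      mul_le_mul_of_nonneg_left (hpos w x) (by positivity)
    rw [Pi.smul_apply, qform_smul, Complex.re_ofReal_mul, hC, div_mul_eq_mul_div,
      le_div_iff₀ hμpos]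
    linarith
  have hne : ∃ w x, qform x (Z w) ≠ 0 := by
    by_contra! h
    exact hZ0 (funext fun w => eq_zero_of_qform_eq_zero (h w))
  obtain ⟨w, x, hwx⟩ := hne
  by_contra! hlt
  have hgrow : ∀ r : ℕ, (‖μ‖ / lam) ^ r ≤ (qform x (((C : ℂ) • Y) w)).re / ‖qform x (Z w)‖ := by
    intro r
    have h1 := norm_qform_tiltedT_pow_le V (z := fun v => (t v : ℂ)) (t := t)
      (fun v => Complex.ofReal_re _) hdom r w x
    rw [hpow μ Z hZ, map_smul, hpow _ Y hY, smul_comm] at h1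
    rw [Pi.smul_apply, qform_smul, norm_mul, norm_pow] at h1
    rw [Pi.smul_apply ((lam : ℂ) ^ r), qform_smul, ← Complex.ofReal_pow,
      Complex.re_ofReal_mul] at h1
    rw [div_pow, div_le_div_iff₀ (pow_pos hlam r) (norm_pos_iff.2 hwx)]
    linarith
  obtain ⟨r, hr⟩ := pow_unbounded_of_one_lt
    ((qform x (((C : ℂ) • Y) w)).re / ‖qform x (Z w)‖) ((one_lt_div hlam).2 hlt)
  exact absurd (hgrow r) (not_le.2 hr)

lemma contDiff_tiltedT :
    ContDiff ℂ ω fun q : ((Fin (m' + 1) → Fin k) → ℂ) ×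
      ((Fin m' → Fin k) → Matrix (Fin d) (Fin d) ℂ) => tiltedT V q.1 q.2 := by
  rw [contDiff_pi]
  intro w
  simp only [tiltedT_apply]
  refine ContDiff.sum fun j _ => ContDiff.fun_smul ?_ ?_
  · fun_prop
  · let L : ((Fin m' → Fin k) → Matrix (Fin d) (Fin d) ℂ) →ₗ[ℂ] Matrix (Fin d) (Fin d) ℂ :=
      (LinearMap.mulRight ℂ (V ((Fin.snoc w j : Fin (m' + 1) → Fin k) 0)) ∘ₗ
        LinearMap.mulLeft ℂ (V ((Fin.snoc w j : Fin (m' + 1) → Fin k) 0))ᴴ) ∘ₗ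
        LinearMap.proj (Fin.tail (Fin.snoc w j : Fin (m' + 1) → Fin k))
    exact (LinearMap.toContinuousLinearMap L).contDiff.comp contDiff_snd

lemma continuous_tailSum (w : Fin m' → Fin k) :
    Continuous fun q : ((Fin (m' + 1) → Fin k) → ℂ) ×
      ((Fin m' → Fin k) → Matrix (Fin d) (Fin d) ℂ) => tailSum q.1 q.2 w := by
  unfold tailSum windowSum
  fun_prop

lemma mem_Bsub_of_eigenvector {Q : (Fin m' → Fin k) → Matrix (Fin d) (Fin d) ℂ}
    (hQherm : ∀ w, (Q w).IsHermitian) (hQrange : ∀ w, Q w * Mmat V w = Mmat V w)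
    {z : (Fin (m' + 1) → Fin k) → ℂ} {Y : (Fin m' → Fin k) → Matrix (Fin d) (Fin d) ℂ} {c : ℂ}
    (hc : c ≠ 0) (hY : (tiltedT V z ^ m') Y = c • Y) : Y ∈ Bsub Q := by
  intro w
  have h1 : prodRev V w * Q w = prodRev V w := by
    have h2 : Mmat V w * Q w = Mmat V w := by
      have h3 := congrArg Matrix.conjTranspose (hQrange w)
      rw [Matrix.conjTranspose_mul, (hQherm w).eq] at h3
      simpa [Mmat] using h3
    have h4 : (prodRev V w)ᴴ * (prodRev V w * (Q w - 1)) = 0 := by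
      rw [← Matrix.mul_assoc, Matrix.mul_sub, Matrix.mul_one]
      exact sub_eq_zero.2 h2
    rw [← Matrix.mul_assoc, Matrix.conjTranspose_mul_self_mul_eq_zero] at h4
    simpa [Matrix.mul_sub, sub_eq_zero] using h4
  have h5 : Q w * (prodRev V w)ᴴ = (prodRev V w)ᴴ := by
    simpa [(hQherm w).eq] using congrArg Matrix.conjTranspose h1
  have h6 := congrFun hY w
  rw [tiltedT_pow_eq, Pi.smul_apply] at h6
  have h7 : Y w = c⁻¹ • ((prodRev V w)ᴴ * tailSum z Y w * prodRev V w) := by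
    rw [h6, smul_smul, inv_mul_cancel₀ hc, one_smul]
  rw [h7, Matrix.mul_smul, Matrix.smul_mul]
  congr 1
  calc _ = (Q w * (prodRev V w)ᴴ) * tailSum z Y w * (prodRev V w * Q w) := by rw [h1, h5]
    _ = _ := by simp only [Matrix.mul_assoc]

end TiltedOperator

section SpectralRadius

open scoped ContDiff Topology

attribute [local instance] Matrix.normedAddCommGroup Matrix.normedSpace

variable {d k m' : ℕ} (V : Fin k → Matrix (Fin d) (Fin d) ℂ)

lemma continuous_complexify {ι : Type*} :
    Continuous fun t : ι → ℝ => fun v => (t v : ℂ) := by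
  fun_prop

lemma spectralRadius_eq_of_dominates {Q : (Fin m' → Fin k) → Matrix (Fin d) (Fin d) ℂ}
    {t : (Fin (m' + 1) → Fin k) → ℝ} {R : Module.End ℂ ↥(Bsub Q)}
    (hR : ∀ Y : ↥(Bsub Q), (R Y : (Fin m' → Fin k) → Matrix (Fin d) (Fin d) ℂ) =
      tiltedT V (fun v => (t v : ℂ)) Y)
    {lam : ℝ} (hlam : 0 < lam) {Y : (Fin m' → Fin k) → Matrix (Fin d) (Fin d) ℂ}
    (hYB : Y ∈ Bsub Q) (hY0 : Y ≠ 0) (hY : tiltedT V (fun v => (t v : ℂ)) Y = (lam : ℂ) • Y)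
    (hpos : ∀ w x, (qform (prodRev V w *ᵥ x) 1).re ≤ 2 * (qform x (Y w)).re) :
    spectralRadius ℂ R = ENNReal.ofReal lam := by
  apply le_antisymm
  · refine iSup₂_le fun μ hμ => ?_
    rw [← Module.End.hasEigenvalue_iff_mem_spectrum] at hμ
    obtain ⟨Z, hZ⟩ := hμ.exists_hasEigenvector
    have h1 := congrArg Subtype.val hZ.apply_eq_smul
    rw [hR] at h1
    have h2 := norm_eigenvalue_le V hlam hY hpos (fun h => hZ.2 (Subtype.ext h)) h1
    rw [ENNReal.ofReal, ENNReal.coe_le_coe, ← NNReal.coe_le_coe, Real.coe_toNNReal _ hlam.le]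
    exact h2
  · have h1 : R.HasEigenvalue (lam : ℂ) := by
      refine Module.End.hasEigenvalue_of_hasEigenvector (x := ⟨Y, hYB⟩) ⟨?_, ?_⟩
      · rw [Module.End.mem_eigenspace_iff]
        exact Subtype.ext ((hR _).trans hY)
      · exact fun h => hY0 (congrArg Subtype.val h)
    have h2 := Module.End.hasEigenvalue_iff_mem_spectrum.1 h1
    refine le_trans ?_ (le_iSup₂ (f := fun (μ : ℂ) (_ : μ ∈ spectrum ℂ R) => (‖μ‖₊ : ENNReal))
      (lam : ℂ) h2)
    rw [ENNReal.ofReal, ENNReal.coe_le_coe, ← NNReal.coe_le_coe, Real.coe_toNNReal _ hlam.le]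
    simp [abs_of_pos hlam]

/-- The analytic branch of the leading eigenvalue of the tilted operators: it computes the spectral
radius for small real parameters and the growth of the powers for small imaginary parameters. -/
theorem exists_leading_eigenvalue (hd : 1 ≤ d) (hnorm : ∑ i : Fin k, (V i)ᴴ * V i = 1)
    (hprim : ∃ n : ℕ, ∀ A : Matrix (Fin d) (Fin d) ℂ,
      A.PosSemidef → A ≠ 0 → ((Tmap V)^[n] A).PosDef) {ψ : Fin d → ℂ}
    (hψ : ∑ x : Fin d, ‖ψ x‖ ^ 2 = 1) {Q : (Fin m' → Fin k) → Matrix (Fin d) (Fin d) ℂ}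
    (hQherm : ∀ w, (Q w).IsHermitian) (hQrange : ∀ w, Q w * Mmat V w = Mmat V w)
    {S : ((Fin (m' + 1) → Fin k) → ℝ) → Module.End ℂ ↥(Bsub Q)}
    (hS : ∀ t (Y : ↥(Bsub Q)), ((S t Y : (Fin m' → Fin k) → Matrix (Fin d) (Fin d) ℂ))
      = extT V t (Y : (Fin m' → Fin k) → Matrix (Fin d) (Fin d) ℂ)) :
    ∃ lam : ((Fin (m' + 1) → Fin k) → ℂ) → ℂ, ContDiffAt ℂ ω lam 0 ∧ lam 0 = 1 ∧
      (∀ᶠ t : (Fin (m' + 1) → Fin k) → ℝ in 𝓝 0, 0 < (lam fun v => (t v : ℂ)).re ∧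
        (lam fun v => (t v : ℂ)).im = 0 ∧
        spectralRadius ℂ (S t) = ENNReal.ofReal (lam fun v => (t v : ℂ)).re) ∧
      ∃ b : ((Fin (m' + 1) → Fin k) → ℂ) → ℝ, Filter.Tendsto b (𝓝 0) (𝓝 0) ∧
        ∀ᶠ z : (Fin (m' + 1) → Fin k) → ℂ in 𝓝 0, (∀ v, (z v).re = 0) → ∀ r : ℕ,
          ‖stateFunctional ψ ((tiltedT V z ^ r) (Mmat V)) - lam z ^ r‖ ≤ b z := by
  obtain ⟨Y, lam, hlam, hYc, hY0, hlam0, heig, huniq⟩ :=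
    exists_analytic_eigenpair (tiltedT V) (contDiff_tiltedT V) (Mmat (m' := m') V)
      (stateFunctional ψ) (tiltedT_zero_Mmat V hnorm) (stateFunctional_Mmat V hnorm hψ)
      (tiltedT_zero_simple V hd hnorm hprim hψ)
  have hpow : ∀ z : (Fin (m' + 1) → Fin k) → ℂ, tiltedT V z (Y z) = lam z • Y z →
      ∀ r : ℕ, (tiltedT V z ^ r) (Y z) = lam z ^ r • Y z := by
    intro z hz r
    induction r with
    | zero => simp
    | succ r ih => rw [pow_succ', Module.End.mul_apply, ih, map_smul, hz, smul_smul, pow_succ]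
  refine ⟨lam, hlam, hlam0, ?_, fun z => ‖Mmat V - Y z‖ * d * (k : ℝ) ^ m', ?_, ?_⟩
  · have hcplx : Filter.Tendsto (fun t : (Fin (m' + 1) → Fin k) → ℝ => fun v => (t v : ℂ))
        (𝓝 0) (𝓝 0) := by
      have := (continuous_complexify (ι := Fin (m' + 1) → Fin k)).tendsto 0
      simpa [Pi.zero_def] using this
    have hlamc : Filter.Tendsto (fun t : (Fin (m' + 1) → Fin k) → ℝ => lam fun v => (t v : ℂ))
        (𝓝 0) (𝓝 1) := by
      rw [← hlam0]; exact hlam.continuousAt.tendsto.comp hcplx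
    have hYt : Filter.Tendsto (fun t : (Fin (m' + 1) → Fin k) → ℝ => Y fun v => (t v : ℂ))
        (𝓝 0) (𝓝 (Mmat V)) := by
      rw [← hY0]; exact hYc.tendsto.comp hcplx
    have hstarY : Filter.Tendsto (fun t : (Fin (m' + 1) → Fin k) → ℝ =>
        fun w => (Y (fun v => (t v : ℂ)) w)ᴴ) (𝓝 0) (𝓝 (Mmat V)) := by
      have h1 : Continuous fun Z : (Fin m' → Fin k) → Matrix (Fin d) (Fin d) ℂ =>
          fun w => (Z w)ᴴ := by fun_prop
      have h2 := (h1.tendsto (Mmat V)).comp hYt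
      have h3 : (fun w => (Mmat (m' := m') V w)ᴴ) = Mmat V := by
        funext w; simp [Mmat]
      rwa [h3] at h2
    have hstarlam : Filter.Tendsto (fun t : (Fin (m' + 1) → Fin k) → ℝ =>
        star (lam fun v => (t v : ℂ))) (𝓝 0) (𝓝 1) := by
      have h1 := (continuous_star.tendsto (1 : ℂ)).comp hlamc
      rwa [star_one] at h1
    have huniq' := (hcplx.prodMk_nhds (hstarY.prodMk_nhds hstarlam)).eventually huniq
    have hlampos : ∀ᶠ t : (Fin (m' + 1) → Fin k) → ℝ in 𝓝 0, 0 < (lam fun v => (t v : ℂ)).re :=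
      ((Complex.continuous_re.tendsto _).comp hlamc).eventually_const_lt (by simp)
    have hRlim : ∀ w, Filter.Tendsto (fun t : (Fin (m' + 1) → Fin k) → ℝ =>
        ((lam fun v => (t v : ℂ)) ^ m')⁻¹ •
          tailSum (fun v => (t v : ℂ)) (Y fun v => (t v : ℂ)) w) (𝓝 0) (𝓝 1) := by
      intro w
      have h1 := (continuous_tailSum (d := d) (m' := m') (k := k) w).continuousAt.tendsto.comp
        (hcplx.prodMk_nhds hYt)
      simp only [tailSum_zero, sum_Mmat V hnorm] at h1
      have h2 := ((hlamc.pow m').inv₀ (by simp)).smul h1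
      rwa [one_pow, inv_one, one_smul] at h2
    have hd0 : (0 : ℝ) < d := by exact_mod_cast hd
    have hclose : ∀ᶠ t : (Fin (m' + 1) → Fin k) → ℝ in 𝓝 0, ∀ w, ∀ a b,
        ‖(((lam fun v => (t v : ℂ)) ^ m')⁻¹ •
          tailSum (fun v => (t v : ℂ)) (Y fun v => (t v : ℂ)) w - 1) a b‖ ≤ 1 / (2 * d) := by
      refine Filter.eventually_all.2 fun w => ?_
      have h1 := ((hRlim w).sub_const 1).norm
      rw [sub_self, norm_zero] at h1
      filter_upwards [h1.eventually_le_const (show (0 : ℝ) < 1 / (2 * d) by positivity)]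
        with t ht a b
      exact (Matrix.norm_entry_le_entrywise_sup_norm _).trans ht
    filter_upwards [hcplx.eventually heig, huniq', hlampos, hclose] with t ht hu hpos hcl
    have hreal : star (lam fun v => (t v : ℂ)) = lam fun v => (t v : ℂ) := by
      refine ((hu ?_ ?_).2).symm
      · funext w
        have h1 := tiltedT_conjTranspose V (fun v => (t v : ℂ)) (Y fun v => (t v : ℂ)) w
        rw [ht.1] at h1
        simpa using h1.symm
      · have h1 := congrArg star ht.2
        rw [star_one] at h1
        rw [← h1, stateFunctional_apply, stateFunctional_apply, star_sum]
        exact Finset.sum_congr rfl fun w _ => qform_conjTranspose _ _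
    have him : (lam fun v => (t v : ℂ)).im = 0 := Complex.conj_eq_iff_im.1 hreal
    have hre : (((lam fun v => (t v : ℂ)).re : ℝ) : ℂ) = lam fun v => (t v : ℂ) :=
      Complex.ext (by simp) (by simp [him])
    have hne : (lam fun v => (t v : ℂ)) ≠ 0 := fun h => by simp [h] at hpos
    have hp := hpow _ ht.1 m'
    refine ⟨hpos, him, spectralRadius_eq_of_dominates V
      (fun Z => (hS t Z).trans (extT_eq_tiltedT V t _)) hpos
      (mem_Bsub_of_eigenvector V hQherm hQrange (pow_ne_zero m' hne) hp) ?_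
      (by rw [hre]; exact ht.1) ?_⟩
    · intro h
      have := ht.2
      rw [h, map_zero] at this
      exact zero_ne_one this
    · intro w x
      have h1 := congrFun hp w
      rw [tiltedT_pow_eq, Pi.smul_apply] at h1
      have h2 : Y (fun v => (t v : ℂ)) w = (prodRev V w)ᴴ *
          (((lam fun v => (t v : ℂ)) ^ m')⁻¹ •
            tailSum (fun v => (t v : ℂ)) (Y fun v => (t v : ℂ)) w) * prodRev V w := by
        rw [Matrix.mul_smul, Matrix.smul_mul, h1, smul_smul,
          inv_mul_cancel₀ (pow_ne_zero m' hne), one_smul]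
      have h3 := norm_qform_le (hcl w) (prodRev V w *ᵥ x)
      rw [h2, qform_conjTranspose_mul_mul]
      rw [qform_sub] at h3
      have h4 := (Complex.abs_re_le_norm _).trans h3
      rw [Complex.sub_re, abs_le] at h4
      have h5 : 1 / (2 * (d : ℝ)) * d = 1 / 2 := by field_simp
      rw [h5] at h4
      linarith [h4.1]
  · have h1 : Filter.Tendsto (fun z => Mmat (m' := m') V - Y z) (𝓝 0) (𝓝 0) := by
      have := (tendsto_const_nhds (x := Mmat (m' := m') V)).sub hYc.tendsto
      rwa [hY0, sub_self] at this
    have h2 := (h1.norm.mul_const (d : ℝ)).mul_const ((k : ℝ) ^ m')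
    simpa using h2
  · filter_upwards [heig] with z hz him r
    have h1 := norm_stateFunctional_pow_le V hnorm hψ him (Mmat V - Y z) r
    rwa [map_sub, map_sub, hpow z hz.1, map_smul, hz.2, smul_eq_mul, mul_one] at h1

end SpectralRadius

section CumulantExpansion

open scoped ContDiff Topology

/-- Second order expansion along a sequence `ζ r → 0` with `r (ζ r)² → -1`. -/
lemma tendsto_second_order {g : ℂ → ℂ} (hg : AnalyticAt ℂ g 0) (hg0 : g 0 = 0) {ζ : ℕ → ℂ}
    (hζ : Filter.Tendsto ζ Filter.atTop (𝓝 0))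
    (hζ2 : Filter.Tendsto (fun r : ℕ => (r : ℂ) * ζ r ^ 2) Filter.atTop (𝓝 (-1))) :
    Filter.Tendsto (fun r : ℕ => (r : ℂ) * (g (ζ r) - ζ r * deriv g 0)) Filter.atTop
      (𝓝 (-(deriv (deriv g) 0 / 2))) := by
  have h1 := hg.hasFPowerSeriesAt.isBigO_sub_partialSum_pow 3
  have h2 : ∀ y : ℂ, (FormalMultilinearSeries.ofScalars ℂ
      fun n => iteratedDeriv n g 0 / (n.factorial : ℂ)).partialSum 3 y =
        y * deriv g 0 + y ^ 2 * (deriv (deriv g) 0 / 2) := by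
    intro y
    simp only [FormalMultilinearSeries.partialSum, Finset.sum_range_succ,
      FormalMultilinearSeries.ofScalars_apply_eq, Finset.sum_range_zero, iteratedDeriv_zero,
      iteratedDeriv_succ, hg0, Nat.factorial, smul_eq_mul]
    push_cast
    ring
  simp only [h2, zero_add] at h1
  have h1' : (fun r => g (ζ r) - (ζ r * deriv g 0 + ζ r ^ 2 * (deriv (deriv g) 0 / 2)))
      =O[Filter.atTop] fun r => ((‖ζ r‖ ^ 3 : ℝ) : ℂ) :=
    (h1.comp_tendsto hζ).trans (.of_bound' (.of_forall fun r => by simp))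
  have h3 := (Asymptotics.isBigO_refl (fun r : ℕ => (r : ℂ)) Filter.atTop).mul h1'
  have h4 : Filter.Tendsto (fun r : ℕ => (r : ℂ) * ((‖ζ r‖ ^ 3 : ℝ) : ℂ)) Filter.atTop
      (𝓝 0) := by
    rw [tendsto_zero_iff_norm_tendsto_zero]
    have h5 := hζ2.norm.mul hζ.norm
    rw [norm_zero, mul_zero] at h5
    refine h5.congr fun r => ?_
    simp
    ring
  have h5 : Filter.Tendsto (fun r : ℕ => (r : ℂ) *
      (g (ζ r) - (ζ r * deriv g 0 + ζ r ^ 2 * (deriv (deriv g) 0 / 2)))) Filter.atTop (𝓝 0) := by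
    exact h3.trans_tendsto h4
  have h6 := h5.add (hζ2.mul_const (deriv (deriv g) 0 / 2))
  have h7 : 0 + -1 * (deriv (deriv g) 0 / 2) = -(deriv (deriv g) 0 / 2) := by ring
  rw [h7] at h6
  exact h6.congr fun r => by ring

variable {ι : Type*} [Fintype ι]

lemma contDiffAt_of_complexify {L : (ι → ℂ) → ℂ} (hL : ContDiffAt ℂ ω L 0) {F : (ι → ℝ) → ℝ}
    (hF : ∀ᶠ t : ι → ℝ in 𝓝 0, L (fun v => (t v : ℂ)) = F t) : ContDiffAt ℝ ω F 0 := by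
  have h1 : ContDiff ℝ ω fun t : ι → ℝ => fun v => (t v : ℂ) :=
    contDiff_pi.2 fun v => Complex.ofRealCLM.contDiff.comp (contDiff_apply ℝ ℝ v)
  have h2 : ContDiffAt ℝ ω L (fun v => (((0 : ι → ℝ) v : ℝ) : ℂ)) := by
    simpa [← Pi.zero_def] using hL.restrict_scalars ℝ
  have h3 := Complex.reCLM.contDiff.contDiffAt.comp (0 : ι → ℝ) (h2.comp (0 : ι → ℝ) h1.contDiffAt)
  refine h3.congr_of_eventuallyEq ?_
  filter_upwards [hF] with t ht
  simp [ht]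

/-- The derivatives of an analytic extension along a real line. -/
lemma deriv_of_complexify {L : (ι → ℂ) → ℂ} (hL : ContDiffAt ℂ ω L 0) {F : (ι → ℝ) → ℝ}
    (hF : ∀ᶠ t : ι → ℝ in 𝓝 0, L (fun v => (t v : ℂ)) = F t) (u : ι → ℝ) :
    AnalyticAt ℂ (fun ζ : ℂ => L fun v => ζ * u v) 0 ∧
    deriv (fun ζ : ℂ => L fun v => ζ * u v) 0 = (fderiv ℝ F 0 u : ℝ) ∧
    deriv (deriv fun ζ : ℂ => L fun v => ζ * u v) 0 = (fderiv ℝ (fderiv ℝ F) 0 u u : ℝ) := by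
  have hFd := contDiffAt_of_complexify hL hF
  set g : ℂ → ℂ := fun ζ => L fun v => ζ * u v with hg
  have hga : AnalyticAt ℂ g 0 := by
    have h1 : ContDiff ℂ ω fun ζ : ℂ => fun v => ζ * (u v : ℂ) := by fun_prop
    have h2 : ContDiffAt ℂ ω L (fun v => (0 : ℂ) * (u v : ℂ)) := by
      simpa [← Pi.zero_def] using hL
    exact (h2.comp (0 : ℂ) h1.contDiffAt).analyticAt
  have hline : Filter.Tendsto (fun s : ℝ => s • u) (𝓝 0) (𝓝 0) := by
    have : Continuous fun s : ℝ => s • u := by fun_prop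
    simpa using this.tendsto 0
  have hofReal : Filter.Tendsto (fun s : ℝ => (s : ℂ)) (𝓝 0) (𝓝 0) := by
    simpa using Complex.continuous_ofReal.tendsto 0
  have hgF : ∀ᶠ s : ℝ in 𝓝 0, g s = F (s • u) := by
    filter_upwards [hline.eventually hF] with s hs
    rw [← hs]
    simp [hg]
  have hlineD : ∀ s : ℝ, HasDerivAt (fun s : ℝ => s • u) u s := fun s => by
    simpa using (hasDerivAt_id s).smul_const u
  have hdiff : ∀ᶠ t in 𝓝 0, DifferentiableAt ℝ F t :=
    (hFd.eventually (by simp)).mono fun t ht => ht.differentiableAt (by simp)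
  have hd1 : ∀ᶠ s : ℝ in 𝓝 0, deriv g s = (fderiv ℝ F (s • u) u : ℝ) := by
    filter_upwards [hgF.eventually_nhds, hline.eventually hdiff,
      hofReal.eventually hga.eventually_analyticAt] with s h1 h2 h3
    have h4 : HasDerivAt (fun y : ℝ => g y) (deriv g s) s :=
      h3.differentiableAt.hasDerivAt.comp_ofReal
    have h5 : HasDerivAt (fun y : ℝ => ((F (y • u) : ℝ) : ℂ)) ((fderiv ℝ F (s • u) u : ℝ) : ℂ) s :=
      (h2.hasFDerivAt.comp_hasDerivAt s (hlineD s)).ofReal_comp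
    exact (h4.congr_of_eventuallyEq (h1.mono fun _ h => h.symm)).unique h5
  refine ⟨hga, by simpa using hd1.self_of_nhds, ?_⟩
  have h2 : DifferentiableAt ℝ (fderiv ℝ F) ((0 : ℝ) • u) := by
    rw [zero_smul]
    exact (hFd.fderiv_right (m := 1) (by simp)).differentiableAt (by simp)
  have h4 : HasDerivAt (fun y : ℝ => deriv g y) (deriv (deriv g) (0 : ℝ)) 0 := by
    have := hga.deriv.differentiableAt
    rw [← Complex.ofReal_zero] at this
    exact this.hasDerivAt.comp_ofReal
  have h5 : HasDerivAt (fun y : ℝ => ((fderiv ℝ F (y • u) u : ℝ) : ℂ))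
      ((fderiv ℝ (fderiv ℝ F) ((0 : ℝ) • u) u u : ℝ) : ℂ) 0 := by
    have h6 := h2.hasFDerivAt.comp_hasDerivAt 0 (hlineD 0)
    have h7 := h6.clm_apply (hasDerivAt_const (0 : ℝ) u)
    simp only [map_zero, add_zero] at h7
    exact h7.ofReal_comp
  have h6 := (h4.congr_of_eventuallyEq (hd1.mono fun _ h => h.symm)).unique h5
  simpa using h6

lemma eq_sum_smul_single [DecidableEq ι] (u : ι → ℝ) : u = ∑ w, u w • (Pi.single w 1 : ι → ℝ) := by
  conv_lhs => rw [← Finset.univ_sum_single u]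
  refine Finset.sum_congr rfl fun w _ => ?_
  rw [← Pi.single_smul, smul_eq_mul, mul_one]

lemma fderiv_apply_eq_sum [DecidableEq ι] {F : (ι → ℝ) → ℝ} {p : ι → ℝ}
    (hp : ∀ w, p w = fderiv ℝ F 0 (Pi.single w 1)) (u : ι → ℝ) :
    fderiv ℝ F 0 u = ∑ w, u w * p w := by
  conv_lhs => rw [eq_sum_smul_single u]
  simp only [map_sum, map_smul, smul_eq_mul, hp]

lemma hessian_apply {F : (ι → ℝ) → ℝ} (hF : DifferentiableAt ℝ (fderiv ℝ F) 0) (a b : ι → ℝ) :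
    fderiv ℝ (fun t => fderiv ℝ F t a) 0 b = fderiv ℝ (fderiv ℝ F) 0 b a := by
  rw [fderiv_clm_apply hF (differentiableAt_const a)]
  simp

lemma hessian_eq_sum [DecidableEq ι] {F : (ι → ℝ) → ℝ}
    (hF : DifferentiableAt ℝ (fderiv ℝ F) 0) {H : ι → ι → ℝ}
    (hH : ∀ w w', H w w' = fderiv ℝ (fun t => fderiv ℝ F t (Pi.single w 1)) 0 (Pi.single w' 1))
    (u : ι → ℝ) :
    fderiv ℝ (fderiv ℝ F) 0 u u = ∑ w, ∑ w', u w * H w w' * u w' := by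
  conv_lhs => rw [eq_sum_smul_single u]
  simp only [map_sum, map_smul, _root_.sum_apply, _root_.smul_apply, smul_eq_mul, hH,
    hessian_apply hF, Finset.mul_sum]
  exact Finset.sum_congr rfl fun _ _ => Finset.sum_congr rfl fun _ _ => by ring

/-- The limit of the leading term of the characteristic function. -/
lemma tendsto_exp_mul_pow {lam : (ι → ℂ) → ℂ} (hlam : ContDiffAt ℂ ω lam 0) (hlam0 : lam 0 = 1)
    {F : (ι → ℝ) → ℝ}
    (hF : ∀ᶠ t : ι → ℝ in 𝓝 0, Complex.log (lam fun v => (t v : ℂ)) = F t) (u : ι → ℝ)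
    {ζ : ℕ → ℂ} (hζ : Filter.Tendsto ζ Filter.atTop (𝓝 0))
    (hζ2 : Filter.Tendsto (fun r : ℕ => (r : ℂ) * ζ r ^ 2) Filter.atTop (𝓝 (-1))) :
    Filter.Tendsto (fun r : ℕ => Complex.exp (-(r * ζ r * (fderiv ℝ F 0 u : ℝ))) *
      (lam fun v => ζ r * u v) ^ r) Filter.atTop
      (𝓝 (Complex.exp (-((fderiv ℝ (fderiv ℝ F) 0 u u : ℝ) : ℂ) / 2))) := by
  have hL : ContDiffAt ℂ ω (fun z => Complex.log (lam z)) 0 :=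
    (Complex.contDiffAt_log (by simp [hlam0])).comp 0 hlam
  obtain ⟨hga, hg1, hg2⟩ := deriv_of_complexify hL hF u
  have h1 := tendsto_second_order hga (by simp [← Pi.zero_def, hlam0]) hζ hζ2
  rw [hg1, hg2, ← neg_div] at h1
  refine ((Complex.continuous_exp.tendsto _).comp h1).congr' ?_
  have hline : Filter.Tendsto (fun s : ℂ => fun v => s * (u v : ℂ)) (𝓝 0) (𝓝 0) := by
    have : Continuous fun s : ℂ => fun v => s * (u v : ℂ) := by fun_prop
    simpa [← Pi.zero_def] using this.tendsto 0
  have hne : ∀ᶠ z in 𝓝 0, lam z ≠ 0 := hlam.continuousAt.eventually_ne (by simp [hlam0])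
  filter_upwards [hζ.eventually (hline.eventually hne)] with r hr
  rw [Function.comp_apply, mul_sub, sub_eq_add_neg, Complex.exp_add, Complex.exp_nat_mul,
    Complex.exp_log hr, mul_comm, mul_assoc]

end CumulantExpansion

section DiscreteLaws

open scoped Topology

/-- Lévy's continuity theorem with Gaussian limit, for finitely supported laws. -/
theorem exists_gaussian_limit {ι : Type*} [Fintype ι] {Ω : ℕ → Type*} [∀ r, Fintype (Ω r)]
    {q : ∀ r, Ω r → ℝ} (hq0 : ∀ r i, 0 ≤ q r i) (hq1 : ∀ r, ∑ i, q r i = 1)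
    (X : ∀ r, Ω r → ι → ℝ) {H : ι → ι → ℝ} (hH : ∀ w w', H w w' = H w' w)
    (hlim : ∀ u : ι → ℝ, Filter.Tendsto
      (fun r => ∑ i, (q r i : ℂ) * Complex.exp (Complex.I * ((∑ w, u w * X r i w : ℝ) : ℂ)))
      Filter.atTop (𝓝 (Complex.exp (-((∑ w, ∑ w', u w * H w w' * u w' : ℝ) : ℂ) / 2)))) :
    ∃ γ : Measure (ι → ℝ), IsProbabilityMeasure γ ∧
      (∀ u : ι → ℝ, ∫ x, Complex.exp (Complex.I * ((∑ w, u w * x w : ℝ) : ℂ)) ∂γ =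
        Complex.exp (-((∑ w, ∑ w', u w * H w w' * u w' : ℝ) : ℂ) / 2)) ∧
      ∀ f : BoundedContinuousFunction (ι → ℝ) ℝ,
        Filter.Tendsto (fun r => ∑ i, q r i * f (X r i)) Filter.atTop (𝓝 (∫ x, f x ∂γ)) := by
  have hdot : ∀ u : ι → ℝ, u ⬝ᵥ Matrix.of H *ᵥ u = ∑ w, ∑ w', u w * H w w' * u w' := fun u => by
    simp [dotProduct, Matrix.mulVec, Finset.mul_sum, mul_assoc]
  have hpsd : (Matrix.of H).PosSemidef := by
    refine Matrix.PosSemidef.of_dotProduct_mulVec_nonneg (Matrix.ext fun a b => ?_) fun u => ?_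
    · simpa using hH b a
    · rw [star_trivial, hdot]
      have h1 := (hlim u).norm
      rw [Complex.norm_exp] at h1
      have h2 : ∀ r, ‖∑ i, (q r i : ℂ) *
          Complex.exp (Complex.I * ((∑ w, u w * X r i w : ℝ) : ℂ))‖ ≤ 1 := by
        intro r
        rw [← hq1 r]
        refine (norm_sum_le _ _).trans (Finset.sum_le_sum fun i _ => ?_)
        rw [norm_mul, Complex.norm_real, mul_comm Complex.I, Complex.norm_exp_ofReal_mul_I,
          mul_one, Real.norm_of_nonneg (hq0 r i)]
      have h3 := le_of_tendsto' h1 h2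
      rw [Real.exp_le_one_iff, ← Complex.ofReal_neg, Complex.div_ofNat_re,
        Complex.ofReal_re] at h3
      linarith
  set e : EuclideanSpace ℝ ι → ι → ℝ := fun x => x.ofLp with he
  have hec : Continuous e := by fun_prop
  have hem : Measurable e := hec.measurable
  set γ₀ : Measure (EuclideanSpace ℝ ι) := ProbabilityTheory.multivariateGaussian 0 (Matrix.of H)
  set law : ∀ r, Measure (EuclideanSpace ℝ ι) := fun r =>
    ∑ i, ENNReal.ofReal (q r i) • Measure.dirac (WithLp.toLp 2 (X r i)) with hlaw
  have hprob : ∀ r, IsProbabilityMeasure (law r) := fun r => ⟨by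
    simp only [hlaw, Measure.coe_finsetSum, Finset.sum_apply, Measure.smul_apply, smul_eq_mul,
      measure_univ, mul_one]
    rw [← ENNReal.ofReal_sum_of_nonneg fun i _ => hq0 r i, hq1, ENNReal.ofReal_one]⟩
  have hint : ∀ {G : Type} [NormedAddCommGroup G] [NormedSpace ℝ G] [CompleteSpace G] (r : ℕ)
      (f : EuclideanSpace ℝ ι → G),
      ∫ x, f x ∂(law r) = ∑ i, q r i • f (WithLp.toLp 2 (X r i)) := by
    intro G _ _ _ r f
    rw [hlaw, integral_finsetSum_measure fun i _ =>
      (integrable_dirac (by simp)).smul_measure ENNReal.ofReal_ne_top]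
    refine Finset.sum_congr rfl fun i _ => ?_
    rw [integral_smul_measure, integral_dirac, ENNReal.toReal_ofReal (hq0 r i)]
  have hchar : ∀ x : EuclideanSpace ℝ ι, charFun γ₀ x =
      Complex.exp (-((∑ w, ∑ w', x w * H w w' * x w' : ℝ) : ℂ) / 2) := fun x => by
    rw [ProbabilityTheory.charFun_multivariateGaussian hpsd, hdot]
    simp [neg_div]
  have hinner : ∀ x t : EuclideanSpace ℝ ι, inner ℝ x t = ∑ w, t w * x w := fun x t => by
    simp [PiLp.inner_apply]
  let laws : ℕ → ProbabilityMeasure (EuclideanSpace ℝ ι) := fun r => ⟨law r, hprob r⟩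
  let γ₁ : ProbabilityMeasure (EuclideanSpace ℝ ι) := ⟨γ₀, inferInstance⟩
  have hconv : Filter.Tendsto laws Filter.atTop (𝓝 γ₁) := by
    rw [ProbabilityMeasure.tendsto_iff_tendsto_charFun]
    intro t
    refine Filter.Tendsto.congr (fun r => ?_) ((hlim t.ofLp).trans (by rw [← hchar]; rfl))
    rw [charFun_apply]
    refine Eq.trans ?_ (hint r _).symm
    refine Finset.sum_congr rfl fun i _ => ?_
    rw [hinner, Complex.real_smul, mul_comm Complex.I]
  refine ⟨γ₀.map e, Measure.isProbabilityMeasure_map hem.aemeasurable, fun u => ?_, fun f => ?_⟩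
  · rw [integral_map hem.aemeasurable (Continuous.aestronglyMeasurable (by fun_prop))]
    refine Eq.trans ?_ (hchar (WithLp.toLp 2 u))
    rw [charFun_apply]
    refine integral_congr_ae (.of_forall fun x => ?_)
    simp only [hinner, he]
    rw [mul_comm]
  · rw [integral_map hem.aemeasurable f.continuous.aestronglyMeasurable]
    have h1 := ProbabilityMeasure.tendsto_iff_forall_integral_tendsto.1 hconv
      (f.compContinuous ⟨e, hec⟩)
    refine h1.congr fun r => ?_
    exact hint r _

end DiscreteLaws

section OutputProcess

open scoped Topology

variable {d k m' : ℕ} (V : Fin k → Matrix (Fin d) (Fin d) ℂ)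

lemma outProb_eq_qform {n : ℕ} (ψ : Fin d → ℂ) (i : Fin n → Fin k) :
    (outProb V ψ i : ℂ) = qform ψ ((prodRev V i)ᴴ * prodRev V i) := by
  rw [← Matrix.mul_one (prodRev V i)ᴴ, qform_conjTranspose_mul_mul, qform_one, outProb]

/-- The moment generating function of the window sums in terms of the tilted operator. -/
lemma sum_outProb_mul_exp (ψ : Fin d → ℂ) (z : (Fin (m' + 1) → Fin k) → ℂ) (r : ℕ) :
    ∑ i : Fin (m' + r) → Fin k, (outProb V ψ i : ℂ) * Complex.exp (windowSum z r i) =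
      stateFunctional ψ ((tiltedT V z ^ r) (Mmat V)) := by
  have h1 := sum_smul_tiltedT_pow V (fun _ => 1) z r (Mmat V)
  simp only [one_smul, one_mul] at h1
  rw [stateFunctional_apply, ← qform_sum, h1, qform_sum]
  refine Finset.sum_congr rfl fun i _ => ?_
  rw [outProb_eq_qform, qform_smul, mul_comm, prodRev_split V (add_comm r m') i]
  simp only [Mmat, Matrix.conjTranspose_mul, Matrix.mul_assoc]

lemma sum_outProb (hnorm : ∑ i : Fin k, (V i)ᴴ * V i = 1) {ψ : Fin d → ℂ}
    (hψ : ∑ x : Fin d, ‖ψ x‖ ^ 2 = 1) (n : ℕ) :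
    ∑ i : Fin n → Fin k, outProb V ψ i = 1 := by
  have h1 := congrArg (qform ψ) (sum_Mmat (m' := n) V hnorm)
  rw [qform_sum, qform_one, hψ] at h1
  simp only [Mmat, ← outProb_eq_qform] at h1
  exact_mod_cast h1

lemma windowSum_eq_empMeas (c : ℂ) (u : (Fin (m' + 1) → Fin k) → ℝ) {r : ℕ} (hr : r ≠ 0)
    (i : Fin (m' + r) → Fin k) :
    windowSum (fun v => c * u v) r i =
      c * r * ((∑ w, u w * empMeas (m' := m') (m' + r) i w : ℝ) : ℂ) := by
  have h1 : ∀ w, (r : ℝ) * empMeas (m' := m') (m' + r) i w =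
      ∑ j : Fin r, if (fun l : Fin (m' + 1) => i ⟨j.1 + l.1, by omega⟩) = w then 1 else 0 := by
    intro w
    have h2 : m' + r - m' = r := Nat.add_sub_cancel_left _ _
    have h3 : ((m' + r - m' : ℕ) : ℝ) = r := by rw [h2]
    rw [empMeas, h3, mul_inv_cancel_left₀ (by exact_mod_cast hr),
      ← (finCongr h2.symm).sum_comp]
    rfl
  have h2 : (r : ℝ) * ∑ w, u w * empMeas (m' := m') (m' + r) i w =
      ∑ j : Fin r, u (fun l : Fin (m' + 1) => i ⟨j.1 + l.1, by omega⟩) := by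
    rw [Finset.mul_sum]
    simp only [mul_left_comm (r : ℝ), h1, Finset.mul_sum, mul_ite, mul_one, mul_zero]
    rw [Finset.sum_comm]
    simp
  rw [mul_assoc, windowSum, ← Finset.mul_sum]
  congr 1
  exact_mod_cast h2.symm

end OutputProcess

section CharacteristicFunction

open scoped ContDiff Topology

lemma tendsto_imaginary_scale (m' : ℕ) :
    Filter.Tendsto (fun r : ℕ => Complex.I * (Real.sqrt (m' + r) / r : ℝ)) Filter.atTop (𝓝 0) ∧
    Filter.Tendsto (fun r : ℕ => (r : ℂ) * (Complex.I * (Real.sqrt (m' + r) / r : ℝ)) ^ 2)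
      Filter.atTop (𝓝 (-1)) := by
  have hinv : Filter.Tendsto (fun r : ℕ => (r : ℝ)⁻¹) Filter.atTop (𝓝 0) :=
    tendsto_inv_atTop_nhds_zero_nat
  have h1 : Filter.Tendsto (fun r : ℕ => (m' : ℝ) * (r : ℝ)⁻¹ + 1) Filter.atTop (𝓝 1) := by
    simpa using (hinv.const_mul (m' : ℝ)).add_const 1
  constructor
  · have h2 : Filter.Tendsto (fun r : ℕ => Real.sqrt (((m' : ℝ) * (r : ℝ)⁻¹ + 1) * (r : ℝ)⁻¹))
        Filter.atTop (𝓝 0) := by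
      simpa using (h1.mul hinv).sqrt
    have h3 : Filter.Tendsto (fun r : ℕ => Real.sqrt (m' + r) / r) Filter.atTop (𝓝 0) := by
      refine h2.congr' ?_
      filter_upwards [Filter.eventually_gt_atTop 0] with r hr
      have hr' : (0 : ℝ) < r := by exact_mod_cast hr
      rw [Real.sqrt_eq_iff_eq_sq (by positivity) (by positivity), div_pow,
        Real.sq_sqrt (by positivity)]
      field_simp
    have h4 := ((Complex.continuous_ofReal.tendsto 0).comp h3).const_mul Complex.I
    simpa using h4
  · have h2 := ((Complex.continuous_ofReal.tendsto 1).comp h1).neg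
    rw [Complex.ofReal_one] at h2
    refine h2.congr' ?_
    filter_upwards [Filter.eventually_gt_atTop 0] with r hr
    have hr' : (r : ℝ) ≠ 0 := by exact_mod_cast hr.ne'
    have h3 : (r : ℝ) * (Real.sqrt (m' + r) / r) ^ 2 = (m' : ℝ) * (r : ℝ)⁻¹ + 1 := by
      rw [div_pow, Real.sq_sqrt (by positivity)]
      field_simp
    rw [mul_pow, Complex.I_sq, Function.comp_apply, ← h3]
    push_cast
    ring

/-- Pointwise convergence of the characteristic functions of the centred and scaled empirical
measures. -/
lemma tendsto_charFun_empMeas {d k m' : ℕ} (V : Fin k → Matrix (Fin d) (Fin d) ℂ)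
    {ψ : Fin d → ℂ} {lam : ((Fin (m' + 1) → Fin k) → ℂ) → ℂ}
    (hlam : ContDiffAt ℂ ω lam 0) (hlam0 : lam 0 = 1) {F : ((Fin (m' + 1) → Fin k) → ℝ) → ℝ}
    (hF : ∀ᶠ t : (Fin (m' + 1) → Fin k) → ℝ in 𝓝 0, Complex.log (lam fun v => (t v : ℂ)) = F t)
    {b : ((Fin (m' + 1) → Fin k) → ℂ) → ℝ} (hb : Filter.Tendsto b (𝓝 0) (𝓝 0))
    (hbound : ∀ᶠ z : (Fin (m' + 1) → Fin k) → ℂ in 𝓝 0, (∀ v, (z v).re = 0) → ∀ r : ℕ,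
      ‖stateFunctional ψ ((tiltedT V z ^ r) (Mmat V)) - lam z ^ r‖ ≤ b z)
    {p : (Fin (m' + 1) → Fin k) → ℝ} (hp : ∀ u, fderiv ℝ F 0 u = ∑ w, u w * p w)
    (u : (Fin (m' + 1) → Fin k) → ℝ) :
    Filter.Tendsto (fun r : ℕ => ∑ i : Fin (m' + r) → Fin k, (outProb V ψ i : ℂ) *
        Complex.exp (Complex.I * ((∑ w, u w *
          (Real.sqrt ((m' + r : ℕ) : ℝ) • (empMeas (m' := m') (m' + r) i - p)) w : ℝ) : ℂ)))
      Filter.atTop (𝓝 (Complex.exp (-((fderiv ℝ (fderiv ℝ F) 0 u u : ℝ) : ℂ) / 2))) := by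
  obtain ⟨hζ, hζ2⟩ := tendsto_imaginary_scale m'
  set ζ : ℕ → ℂ := fun r => Complex.I * (Real.sqrt (m' + r) / r : ℝ) with hζdef
  have hmain := tendsto_exp_mul_pow hlam hlam0 hF u hζ hζ2
  have hline : Filter.Tendsto (fun r : ℕ => fun v => ζ r * (u v : ℂ)) Filter.atTop (𝓝 0) := by
    have h1 : Continuous fun s : ℂ => fun v => s * (u v : ℂ) := by fun_prop
    have h2 := (h1.tendsto 0).comp hζ
    simpa [← Pi.zero_def, Function.comp_def] using h2
  have him : ∀ r v, (ζ r * (u v : ℂ)).re = 0 := fun r v => by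
    rw [hζdef, mul_assoc, ← Complex.ofReal_mul, Complex.I_mul_re, Complex.ofReal_im, neg_zero]
  have hphase : ∀ r : ℕ, ‖Complex.exp (-(r * ζ r * (fderiv ℝ F 0 u : ℝ)))‖ = 1 := fun r => by
    have h1 : -(r * ζ r * (fderiv ℝ F 0 u : ℝ)) =
        ((-(r * (Real.sqrt (m' + r) / r) * fderiv ℝ F 0 u) : ℝ) : ℂ) * Complex.I := by
      simp only [hζdef]
      push_cast
      ring
    rw [h1, Complex.norm_exp_ofReal_mul_I]
  have herr : Filter.Tendsto (fun r : ℕ => Complex.exp (-(r * ζ r * (fderiv ℝ F 0 u : ℝ))) *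
      (stateFunctional ψ ((tiltedT V (fun v => ζ r * (u v : ℂ)) ^ r) (Mmat V)) -
        (lam fun v => ζ r * u v) ^ r)) Filter.atTop (𝓝 0) := by
    refine squeeze_zero_norm' ?_ (hb.comp hline)
    filter_upwards [hline.eventually hbound] with r hr
    rw [norm_mul, hphase, one_mul]
    exact hr (him r) r
  have hsum := hmain.add herr
  rw [add_zero] at hsum
  refine hsum.congr' ?_
  filter_upwards [Filter.eventually_ne_atTop 0] with r hr
  rw [← mul_add, add_sub_cancel, ← sum_outProb_mul_exp, Finset.mul_sum]
  refine Finset.sum_congr rfl fun i _ => ?_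
  rw [mul_left_comm, ← Complex.exp_add, windowSum_eq_empMeas _ _ hr, hp]
  congr 2
  have hr' : (r : ℂ) ≠ 0 := by exact_mod_cast hr
  have h1 : (ζ r * r : ℂ) = Complex.I * (Real.sqrt (m' + r) : ℝ) := by
    simp only [hζdef]
    push_cast
    field_simp
  have h2 : ∑ w, u w * (Real.sqrt ((m' + r : ℕ) : ℝ) •
      (empMeas (m' := m') (m' + r) i - p)) w = Real.sqrt (m' + r) *
        ((∑ w, u w * empMeas (m' := m') (m' + r) i w) - ∑ w, u w * p w) := by
    rw [← Finset.sum_sub_distrib, Finset.mul_sum]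
    refine Finset.sum_congr rfl fun w _ => ?_
    simp only [Pi.smul_apply, Pi.sub_apply, smul_eq_mul]
    push_cast
    ring
  rw [h2, mul_comm (r : ℂ), h1]
  push_cast
  ring

end CharacteristicFunction

/-- **Central limit theorem for the empirical measure.** If the transition operator is
primitive, then `F(t) = log r(T̃_{t,m})` is twice differentiable at `t = 0`, and with
`p⁽ᵐ⁾` its gradient and `V⁽ᵐ⁾` its Hessian at `t = 0`, the random vectors
`√n (P̂ₙ⁽ᵐ⁾ − p⁽ᵐ⁾)` converge in distribution to the centered Gaussian on `ℝ^{kᵐ}` with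
covariance `V⁽ᵐ⁾` (characterized by its characteristic function). -/
theorem clt_empirical_measure {d k m' : ℕ} (hd : 1 ≤ d) (hk : 1 ≤ k)
    (V : Fin k → Matrix (Fin d) (Fin d) ℂ)
    (hnorm : ∑ i : Fin k, (V i)ᴴ * V i = 1)
    -- the transition operator is primitive
    (hprim : ∃ n : ℕ, ∀ A : Matrix (Fin d) (Fin d) ℂ,
      A.PosSemidef → A ≠ 0 → ((Tmap V)^[n] A).PosDef)
    -- `ψ` is a unit vector
    (ψ : Fin d → ℂ) (hψ : ∑ x : Fin d, ‖ψ x‖ ^ 2 = 1)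
    -- `Q_w` is the orthogonal projection onto the range of `[M^{(m)}]_w`
    (Q : (Fin m' → Fin k) → Matrix (Fin d) (Fin d) ℂ)
    (hQherm : ∀ w, (Q w).IsHermitian)
    (hQidem : ∀ w, Q w * Q w = Q w)
    (hQrange : ∀ w, Q w * Mmat V w = Mmat V w)
    (hQker : ∀ w (v : Fin d → ℂ), Mmat V w *ᵥ v = 0 → Q w *ᵥ v = 0)
    -- `S t` is the restriction `T̃_{t,m}` of `T_{t,m}` to `B_m`
    (S : ((Fin (m' + 1) → Fin k) → ℝ) → Module.End ℂ ↥(Bsub Q))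
    (hS : ∀ t (Y : ↥(Bsub Q)), ((S t Y : (Fin m' → Fin k) → Matrix (Fin d) (Fin d) ℂ))
      = extT V t (Y : (Fin m' → Fin k) → Matrix (Fin d) (Fin d) ℂ))
    -- `F(t) = log r(T̃_{t,m})`
    (F : ((Fin (m' + 1) → Fin k) → ℝ) → ℝ)
    (hF : ∀ t, F t = Real.log ((spectralRadius ℂ (S t)).toReal))
    -- `p⁽ᵐ⁾` is the gradient of `F` at `t = 0`
    (p : (Fin (m' + 1) → Fin k) → ℝ)
    (hp : ∀ w, p w = fderiv ℝ F 0 (Pi.single w 1))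
    -- `V⁽ᵐ⁾` is the Hessian matrix of `F` at `t = 0`
    (Vm : (Fin (m' + 1) → Fin k) → (Fin (m' + 1) → Fin k) → ℝ)
    (hVm : ∀ w w', Vm w w' =
      fderiv ℝ (fun t => fderiv ℝ F t (Pi.single w 1)) 0 (Pi.single w' 1)) :
    -- `F` is twice differentiable at `t = 0`
    DifferentiableAt ℝ F 0 ∧ DifferentiableAt ℝ (fderiv ℝ F) 0 ∧
    -- and `√n (P̂ₙ⁽ᵐ⁾ − p⁽ᵐ⁾)` converges in distribution to `N(0, V⁽ᵐ⁾)`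
    ∃ γ : Measure ((Fin (m' + 1) → Fin k) → ℝ), IsProbabilityMeasure γ ∧
      -- `γ` is the centered Gaussian with covariance matrix `V⁽ᵐ⁾`
      (∀ u : (Fin (m' + 1) → Fin k) → ℝ,
        ∫ x, Complex.exp (Complex.I * ((∑ w, u w * x w : ℝ) : ℂ)) ∂γ
          = Complex.exp (-(((∑ w, ∑ w', u w * Vm w w' * u w' : ℝ) : ℂ)) / 2)) ∧
      -- weak convergence of the laws of `√n (P̂ₙ⁽ᵐ⁾ − p⁽ᵐ⁾)` to `γ`
      (∀ f : BoundedContinuousFunction ((Fin (m' + 1) → Fin k) → ℝ) ℝ,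
        Filter.Tendsto (fun n : ℕ => ∑ i : Fin n → Fin k,
            outProb V ψ i * f (Real.sqrt n • (empMeas (m' := m') n i - p)))
          Filter.atTop (nhds (∫ x, f x ∂γ))) := by
  obtain ⟨lam, hlam, hlam0, hspec, b, hb, hbound⟩ :=
    exists_leading_eigenvalue V hd hnorm hprim hψ hQherm hQrange hS
  have hFlog : ∀ᶠ t : (Fin (m' + 1) → Fin k) → ℝ in nhds 0,
      Complex.log (lam fun v => (t v : ℂ)) = F t := by
    filter_upwards [hspec] with t ht
    obtain ⟨hpos, him, hrad⟩ := ht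
    rw [hF, hrad, ENNReal.toReal_ofReal hpos.le, Complex.ofReal_log hpos.le]
    congr 1
    exact Complex.ext (by simp) (by simp [him])
  have hlogd : ContDiffAt ℂ ⊤ (fun z => Complex.log (lam z)) 0 :=
    (Complex.contDiffAt_log (by simp [hlam0])).comp 0 hlam
  have hFd := contDiffAt_of_complexify hlogd hFlog
  have hF2 : DifferentiableAt ℝ (fderiv ℝ F) 0 :=
    (hFd.fderiv_right (m := 1) (by simp)).differentiableAt (by simp)
  refine ⟨hFd.differentiableAt (by simp), hF2, ?_⟩
  have hsymm : ∀ w w', Vm w w' = Vm w' w := fun w w' => by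
    rw [hVm, hVm, hessian_apply hF2, hessian_apply hF2]
    exact hFd.isSymmSndFDerivAt (by simp) _ _
  obtain ⟨γ, hγ, hγchar, hγlim⟩ := exists_gaussian_limit
    (q := fun r => fun i : Fin (m' + r) → Fin k => outProb V ψ i)
    (fun r i => Finset.sum_nonneg fun x _ => by positivity)
    (fun r => sum_outProb V hnorm hψ (m' + r))
    (fun r i => Real.sqrt ((m' + r : ℕ) : ℝ) • (empMeas (m' := m') (m' + r) i - p)) hsymm
    (fun u => by
      rw [← hessian_eq_sum hF2 hVm u]
      exact tendsto_charFun_empMeas V hlam hlam0 hFlog hb hbound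
        (fderiv_apply_eq_sum hp) u)
  refine ⟨γ, hγ, hγchar, fun f => (Filter.tendsto_add_atTop_iff_nat m').1 ?_⟩
  refine (hγlim f).congr fun r => ?_
  exact congrArg (fun n : ℕ => ∑ i : Fin n → Fin k,
    outProb V ψ i * f (Real.sqrt n • (empMeas (m' := m') n i - p))) (Nat.add_comm m' r)
end

section
/- Let A be a finite-dimensional unital C*-algebra and R : A → A a positive linear map. Then the spectral radius r(R) is an eigenvalue of R, and R has a nonzero positive eigenvector with eigenvalue r(R). -/
open scoped ComplexOrder
open Filter Topology

/-- The Neumann series of `T` at a real number above the spectral radius is summable. -/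
theorem summable_inv_pow_smul_pow {B : Type*} [NormedRing B] [NormedAlgebra ℂ B]
    [CompleteSpace B] (T : B) {t : ℝ} (ht : (spectralRadius ℂ T).toReal < t)
    (hT : spectralRadius ℂ T ≠ ⊤) :
    Summable fun n : ℕ => ((t⁻¹ : ℝ) : ℂ) ^ n • T ^ n := by
  obtain ⟨s, hs, hst⟩ := exists_between ht
  have hs0 : 0 < s := ENNReal.toReal_nonneg.trans_lt hs
  have ht0 : 0 < t := hs0.trans hst
  have hev := (spectrum.pow_norm_pow_one_div_tendsto_nhds_spectralRadius T).eventually_lt_const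
    ((ENNReal.lt_ofReal_iff_toReal_lt hT).2 hs)
  refine Summable.of_norm_bounded_eventually_nat (g := fun n => (s / t) ^ n)
    (summable_geometric_of_lt_one (by positivity) ((div_lt_one ht0).2 hst)) ?_
  filter_upwards [hev, eventually_ne_atTop 0] with n hn hn0
  have h1 : ‖T ^ n‖ ^ (1 / n : ℝ) < s := (ENNReal.ofReal_lt_ofReal_iff hs0).1 hn
  have h2 : ‖T ^ n‖ ≤ s ^ n := by
    have := pow_le_pow_left₀ (by positivity) h1.le n
    rwa [one_div, Real.rpow_inv_natCast_pow (norm_nonneg _) hn0] at this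
  rw [norm_smul, norm_pow, Complex.norm_of_nonneg (by positivity), div_pow, inv_pow,
    inv_mul_eq_div]
  gcongr

theorem LinearMap.pow_nonneg_of_nonneg {E : Type*} [AddCommGroup E] [Module ℂ E] [Preorder E]
    {R : E →ₗ[ℂ] E} (hR : ∀ a, 0 ≤ a → 0 ≤ R a) (n : ℕ) {a : E} (ha : 0 ≤ a) :
    0 ≤ (R ^ n : Module.End ℂ E) a := by
  induction n with
  | zero => simpa
  | succ n ih => rw [pow_succ', Module.End.mul_apply]; exact hR _ ih

section CStarAlgebra

variable {A : Type*} [CStarAlgebra A] [PartialOrder A] [StarOrderedRing A]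

theorem LinearMap.mono_of_nonneg {R : A →ₗ[ℂ] A} (hR : ∀ a, 0 ≤ a → 0 ≤ R a) : Monotone R :=
  fun a b hab => by simpa using hR _ (sub_nonneg.2 hab)

/-- Collatz–Wielandt bound: an order unit `x` with `R x ≤ q x` bounds every eigenvalue of a
positive map `R` by `q`. -/
theorem norm_le_of_hasEigenvector_of_map_le_smul {R : A →ₗ[ℂ] A} (hR : ∀ a, 0 ≤ a → 0 ≤ R a)
    {x : A} {c q : ℝ} (hc : 0 ≤ c) (hq : 0 ≤ q) (hx : 1 ≤ c • x) (hRx : R x ≤ q • x)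
    {μ : ℂ} {v : A} (hv : Module.End.HasEigenvector (R : Module.End ℂ A) μ v) : ‖μ‖ ≤ q := by
  have hpow (n : ℕ) : (R ^ n : Module.End ℂ A) x ≤ q ^ n • x := by
    induction n with
    | zero => simp
    | succ n ih =>
      rw [pow_succ', Module.End.mul_apply]
      calc R ((R ^ n : Module.End ℂ A) x) ≤ R (q ^ n • x) := LinearMap.mono_of_nonneg hR ih
        _ = q ^ n • R x := R.map_smul_of_tower _ _
        _ ≤ q ^ n • q • x := smul_le_smul_of_nonneg_left hRx (by positivity)
        _ = q ^ (n + 1) • x := by rw [smul_smul, pow_succ]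
  have hbound (a : A) : ∃ C : ℝ, ∀ n : ℕ, ‖(R ^ n : Module.End ℂ A) a‖ ≤ C * q ^ n := by
    have ha : a ∈ Submodule.span ℂ {a : A | 0 ≤ a} := by
      rw [CStarAlgebra.span_nonneg]; trivial
    induction ha using Submodule.span_induction with
    | mem a ha =>
      refine ⟨‖(‖a‖ * c) • x‖, fun n => ?_⟩
      have hax : a ≤ (‖a‖ * c) • x := by
        have h1 : a ≤ algebraMap ℝ A ‖a‖ :=
          IsSelfAdjoint.le_algebraMap_norm_self (ha := IsSelfAdjoint.of_nonneg ha)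
        rw [Algebra.algebraMap_eq_smul_one] at h1
        rw [mul_smul]
        exact h1.trans (smul_le_smul_of_nonneg_left hx (norm_nonneg a))
      have h2 : (R ^ n : Module.End ℂ A) a ≤ q ^ n • (‖a‖ * c) • x := by
        refine (LinearMap.mono_of_nonneg (R := (R ^ n : Module.End ℂ A))
          (fun _ => LinearMap.pow_nonneg_of_nonneg hR n) hax).trans ?_
        rw [LinearMap.map_smul_of_tower, smul_comm (q ^ n)]
        exact smul_le_smul_of_nonneg_left (hpow n) (by positivity)
      have h3 := CStarAlgebra.norm_le_norm_of_nonneg_of_le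
        (LinearMap.pow_nonneg_of_nonneg hR n ha) h2
      rwa [norm_smul, Real.norm_of_nonneg (by positivity), mul_comm] at h3
    | zero => exact ⟨0, by simp⟩
    | add a b _ _ iha ihb =>
      obtain ⟨C, hC⟩ := iha
      obtain ⟨D, hD⟩ := ihb
      refine ⟨C + D, fun n => ?_⟩
      rw [map_add, add_mul]
      exact norm_add_le_of_le (hC n) (hD n)
    | smul z a _ iha =>
      obtain ⟨C, hC⟩ := iha
      refine ⟨‖z‖ * C, fun n => ?_⟩
      rw [map_smul, norm_smul, mul_assoc]
      gcongr
      exact hC n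
  obtain ⟨C, hC⟩ := hbound v
  by_contra! hlt
  have hμ : 0 < ‖μ‖ := hq.trans_lt hlt
  have hlim : Tendsto (fun n : ℕ => C * (q / ‖μ‖) ^ n) atTop (𝓝 (C * 0)) :=
    (tendsto_pow_atTop_nhds_zero_of_lt_one (by positivity) ((div_lt_one hμ).2 hlt)).const_mul C
  have hle : ‖v‖ ≤ C * 0 := by
    refine ge_of_tendsto' hlim fun n => ?_
    have h := hC n
    rw [hv.pow_apply, norm_smul, norm_pow] at h
    rw [div_pow, ← mul_div_assoc, le_div_iff₀ (by positivity), mul_comm]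
    exact h
  exact hv.2 (by simpa using hle)

variable [FiniteDimensional ℂ A]

/-- For `t` above the spectral radius of a positive map `R`, the resolvent at `t` maps `1` to a
nonnegative element. -/
theorem exists_nonneg_smul_sub_map_eq_one {R : A →ₗ[ℂ] A} (hR : ∀ a, 0 ≤ a → 0 ≤ R a) {t : ℝ}
    (ht : (spectralRadius ℂ (Module.End.toContinuousLinearMap A R)).toReal < t) :
    ∃ x : A, 0 ≤ x ∧ t • x - R x = 1 := by
  have ht0 : 0 < t := ENNReal.toReal_nonneg.trans_lt ht
  set T : A →L[ℂ] A := Module.End.toContinuousLinearMap A R with hTdef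
  have hTR (n : ℕ) (a : A) : (T ^ n) a = (R ^ n : Module.End ℂ A) a := by
    rw [hTdef, ← map_pow]; rfl
  have hT : spectralRadius ℂ T ≠ ⊤ := by
    refine (lt_of_le_of_lt (spectrum.spectralRadius_le_pow_nnnorm_pow_one_div ℂ T 0) ?_).ne
    simp [ENNReal.mul_lt_top]
  have hsum := (summable_inv_pow_smul_pow T ht hT).hasSum
  set S := ∑' n : ℕ, ((t⁻¹ : ℝ) : ℂ) ^ n • T ^ n
  have hS : HasSum (fun n : ℕ => t⁻¹ ^ n • (T ^ n) 1) (S 1) := by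
    simpa [← Complex.ofReal_inv, ← Complex.ofReal_pow, Complex.coe_smul] using
      hsum.mapL (ContinuousLinearMap.apply ℂ A (1 : A))
  have hS0 : 0 ≤ S 1 := hS.nonneg fun n => by
    rw [hTR]
    exact smul_nonneg (by positivity) (LinearMap.pow_nonneg_of_nonneg hR n zero_le_one)
  have hTS : T (S 1) = t • (S 1 - 1) := by
    have h1 : HasSum (fun n : ℕ => t⁻¹ ^ n • (T ^ (n + 1)) 1) (T (S 1)) := by
      simpa [pow_succ', T.map_smul_of_tower] using hS.mapL T
    have h2 : HasSum (fun n : ℕ => t⁻¹ ^ (n + 1) • (T ^ (n + 1)) 1) (S 1 - 1) := by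
      simpa using (hasSum_nat_add_iff' 1).2 hS
    refine h1.unique ?_
    convert h2.const_smul t using 2 with n
    rw [smul_smul, pow_succ' t⁻¹, mul_inv_cancel_left₀ ht0.ne']
  refine ⟨t⁻¹ • S 1, smul_nonneg (by positivity) hS0, ?_⟩
  have : R (t⁻¹ • S 1) = t⁻¹ • T (S 1) := R.map_smul_of_tower _ _
  rw [this, hTS, smul_smul, smul_smul, mul_inv_cancel₀ ht0.ne', inv_mul_cancel₀ ht0.ne']
  simp

theorem exists_nonneg_eigenvector_spectralRadius [Nontrivial A] {R : A →ₗ[ℂ] A}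
    (hR : ∀ a, 0 ≤ a → 0 ≤ R a) :
    ∃ y : A, y ≠ 0 ∧ 0 ≤ y ∧ R y = (spectralRadius ℂ (R : Module.End ℂ A)).toReal • y := by
  have hspec : spectrum ℂ (Module.End.toContinuousLinearMap A R) =
      spectrum ℂ (R : Module.End ℂ A) := AlgEquiv.spectrum_eq _ _
  have hrad : spectralRadius ℂ (R : Module.End ℂ A) =
      spectralRadius ℂ (Module.End.toContinuousLinearMap A R) := by
    rw [spectralRadius, spectralRadius, hspec]
  rw [hrad]
  set r := (spectralRadius ℂ (Module.End.toContinuousLinearMap A R)).toReal with hr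
  have hr0 : 0 ≤ r := ENNReal.toReal_nonneg
  have hRcont : Continuous R := R.continuous_of_finiteDimensional
  have hprop : ProperSpace A := FiniteDimensional.proper ℂ A
  have happrox (n : ℕ) : ∃ p : A × ℝ, p ∈ (Metric.sphere (0 : A) 1 ×ˢ Set.Icc 0 (r + 1)) ∧
      0 ≤ p.1 ∧ (r + 1 / ((n : ℝ) + 1)) • p.1 - R p.1 = p.2 • (1 : A) := by
    have hn : 0 < 1 / ((n : ℝ) + 1) := Nat.one_div_pos_of_nat
    have hn1 : 1 / ((n : ℝ) + 1) ≤ 1 :=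
      (div_le_one (by positivity)).2 (by linarith [n.cast_nonneg (α := ℝ)])
    obtain ⟨x, hx0, hx⟩ := exists_nonneg_smul_sub_map_eq_one hR (lt_add_of_pos_right r hn)
    set t := r + 1 / ((n : ℝ) + 1)
    have hxne : x ≠ 0 := by rintro rfl; simp at hx
    have hxpos : 0 < ‖x‖ := norm_pos_iff.2 hxne
    have hle : (1 : A) ≤ t • x := by rw [← hx]; exact sub_le_self _ (hR x hx0)
    have h1 : 1 ≤ t * ‖x‖ := by
      have := CStarAlgebra.norm_le_norm_of_nonneg_of_le zero_le_one hle
      rwa [norm_smul, CStarRing.norm_one, Real.norm_of_nonneg (by positivity)] at this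
    refine ⟨(‖x‖⁻¹ • x, ‖x‖⁻¹), ⟨?_, by positivity, ?_⟩, smul_nonneg (by positivity) hx0, ?_⟩
    · simp [norm_smul, hxpos.ne']
    · exact ((inv_le_iff_one_le_mul₀ hxpos).2 h1).trans (by simp only [t]; linarith)
    · simp only [R.map_smul_of_tower, smul_comm t, ← smul_sub, hx]
  choose p hpK hp0 hp using happrox
  obtain ⟨⟨y, c⟩, ⟨hy, hc0, -⟩, φ, hφ, hlim⟩ :=
    ((isCompact_sphere (0 : A) 1).prod isCompact_Icc).tendsto_subseq hpK
  have hlim1 := (continuous_fst.tendsto _).comp hlim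
  have hlim2 := (continuous_snd.tendsto _).comp hlim
  have hynorm : ‖y‖ = 1 := by simpa using hy
  have hy0 : 0 ≤ y := ge_of_tendsto' hlim1 fun n => hp0 (φ n)
  have hlimt : Tendsto (fun n : ℕ => r + 1 / ((φ n : ℝ) + 1)) atTop (𝓝 r) := by
    simpa using (tendsto_one_div_add_atTop_nhds_zero_nat.comp hφ.tendsto_atTop).const_add r
  have heq : r • y - R y = c • (1 : A) := by
    refine tendsto_nhds_unique
      ((hlimt.smul hlim1).sub ((hRcont.tendsto y).comp hlim1)) ?_
    exact (hlim2.smul_const (1 : A)).congr fun n => (hp (φ n)).symm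
  have hyne : y ≠ 0 := by rintro rfl; simp at hynorm
  rcases (show 0 ≤ c from hc0).eq_or_lt with rfl | hc
  · exact ⟨y, hyne, hy0, by simpa using (sub_eq_zero.1 (heq.trans (zero_smul ℝ _))).symm⟩
  exfalso
  have hc_le : c • (1 : A) ≤ r • y := by rw [← heq]; exact sub_le_self _ (hR y hy0)
  have hcr : c ≤ r := by
    have := CStarAlgebra.norm_le_norm_of_nonneg_of_le (smul_nonneg hc.le zero_le_one) hc_le
    rwa [norm_smul, norm_smul, CStarRing.norm_one, hynorm, Real.norm_of_nonneg hc.le,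
      Real.norm_of_nonneg hr0, mul_one, mul_one] at this
  have hunit : (1 : A) ≤ (c⁻¹ * r) • y := by
    have := smul_le_smul_of_nonneg_left hc_le (inv_nonneg.2 hc.le)
    rwa [smul_smul, smul_smul, inv_mul_cancel₀ hc.ne', one_smul] at this
  have hmap : R y ≤ (r - c) • y := by
    have hy1 : y ≤ 1 := by
      have := IsSelfAdjoint.le_algebraMap_norm_self (ha := IsSelfAdjoint.of_nonneg hy0)
      simpa [hynorm] using this
    rw [← sub_sub_cancel (r • y) (R y), heq, sub_smul]
    exact sub_le_sub_left (smul_le_smul_of_nonneg_left hy1 hc.le) _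
  obtain ⟨μ, hμ, hμr⟩ :=
    spectrum.exists_nnnorm_eq_spectralRadius (Module.End.toContinuousLinearMap A R)
  rw [hspec, ← Module.End.hasEigenvalue_iff_mem_spectrum] at hμ
  obtain ⟨v, hv⟩ := hμ.exists_hasEigenvector
  have hle := norm_le_of_hasEigenvector_of_map_le_smul hR (by positivity) (sub_nonneg.2 hcr) hunit
    hmap hv
  have hμr' : ‖μ‖ = r := by rw [hr, ← hμr]; simp
  linarith

end CStarAlgebra

/-- **Quantum Perron–Frobenius, part (i).** For a positive linear map `R` on a
finite-dimensional unital C*-algebra, the spectral radius `r(R)` is an eigenvalue of `R` and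
`R` has a nonzero positive eigenvector with eigenvalue `r(R)`. -/
theorem spectralRadius_hasEigenvalue_of_positive {A : Type*} [NormedRing A] [StarRing A]
    [CStarRing A] [NormedAlgebra ℂ A] [StarModule ℂ A] [PartialOrder A] [StarOrderedRing A]
    [FiniteDimensional ℂ A] [Nontrivial A]
    (R : A →ₗ[ℂ] A) (hR : ∀ a : A, 0 ≤ a → 0 ≤ R a) :
    Module.End.HasEigenvalue (R : Module.End ℂ A)
        (((spectralRadius ℂ (R : Module.End ℂ A)).toReal : ℝ) : ℂ) ∧
      ∃ y : A, y ≠ 0 ∧ 0 ≤ y ∧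
        R y = (((spectralRadius ℂ (R : Module.End ℂ A)).toReal : ℝ) : ℂ) • y := by
  let _ : CompleteSpace A := FiniteDimensional.complete ℂ A
  let _ : CStarAlgebra A := { }
  obtain ⟨y, hy, hy0, hRy⟩ := exists_nonneg_eigenvector_spectralRadius hR
  rw [← Complex.coe_smul] at hRy
  exact ⟨Module.End.hasEigenvalue_of_hasEigenvector ⟨Module.End.mem_eigenspace_iff.2 hRy, hy⟩,
    y, hy, hy0, hRy⟩
end

section
/- (Gärtner–Ellis theorem.) Let (μ_n)_{n ∈ ℕ} be a sequence of Borel probability measures on ℝ^d and let Γ_n(t) = ∫_{ℝ^d} e^{n⟨t,x⟩} dμ_n(x) for t ∈ ℝ^d. Suppose the limit F(t) = lim_{n→∞} (1/n) log Γ_n(t) exists and is finite for every t ∈ ℝ^d, and that F : ℝ^d → ℝ is differentiable. Then (μ_n) satisfies a large deviation principle with rate function I(x) = sup_{t ∈ ℝ^d} ( ⟨t,x⟩ − F(t) ): for every Borel set B ⊆ ℝ^d, −inf_{x ∈ int(B)} I(x) ≤ liminf_{n→∞} (1/n) log μ_n(B) ≤ limsup_{n→∞} (1/n) log μ_n(B)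 ≤ −inf_{x ∈ cl(B)} I(x). -/
open MeasureTheory Filter

lemma Real.eventually_exp_le_of_tendsto_log_div {g : ℕ → ℝ} {L a : ℝ} (hg : ∀ n, 0 < g n)
    (h : Tendsto (fun n : ℕ => Real.log (g n) / n) atTop (nhds L)) (ha : a < L) :
    ∀ᶠ n : ℕ in atTop, Real.exp (n * a) ≤ g n := by
  filter_upwards [h.eventually_const_lt ha, eventually_gt_atTop 0] with n hn hn0
  have hn0' : (0 : ℝ) < n := by exact_mod_cast hn0
  rw [lt_div_iff₀ hn0'] at hn
  rw [← Real.le_log_iff_exp_le (hg n)]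
  linarith

lemma Real.eventually_le_exp_of_tendsto_log_div {g : ℕ → ℝ} {L a : ℝ} (hg : ∀ n, 0 < g n)
    (h : Tendsto (fun n : ℕ => Real.log (g n) / n) atTop (nhds L)) (ha : L < a) :
    ∀ᶠ n : ℕ in atTop, g n ≤ Real.exp (n * a) := by
  filter_upwards [h.eventually_lt_const ha, eventually_gt_atTop 0] with n hn hn0
  have hn0' : (0 : ℝ) < n := by exact_mod_cast hn0
  rw [div_lt_iff₀ hn0'] at hn
  rw [← Real.log_le_iff_le_exp (hg n)]
  linarith

lemma Real.eventually_mul_exp_le_exp (C : ℝ) {a b : ℝ} (hab : a < b) :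
    ∀ᶠ n : ℕ in atTop, C * Real.exp (n * a) ≤ Real.exp (n * b) := by
  have h : Tendsto (fun n : ℕ => Real.exp (n * (b - a))) atTop atTop :=
    Real.tendsto_exp_atTop.comp
      (tendsto_natCast_atTop_atTop.atTop_mul_const (sub_pos.2 hab))
  filter_upwards [h.eventually_ge_atTop C] with n hn
  calc C * Real.exp (n * a) ≤ Real.exp (n * (b - a)) * Real.exp (n * a) := by gcongr
    _ = Real.exp (n * b) := by rw [← Real.exp_add]; ring_nf

section Tilting

variable {d : ℕ} {μ : ℕ → Measure (Fin d → ℝ)} {F : (Fin d → ℝ) → ℝ}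

/-- Chernoff bound for the tilted measures on a finite union of half-spaces. -/
lemma eventually_setIntegral_exp_le [∀ n, IsProbabilityMeasure (μ n)]
    (hint : ∀ (n : ℕ) (t : Fin d → ℝ),
      Integrable (fun x : Fin d → ℝ => Real.exp (n * (t ⬝ᵥ x))) (μ n))
    (hF : ∀ t : Fin d → ℝ,
      Tendsto (fun n : ℕ => Real.log (∫ x, Real.exp (n * (t ⬝ᵥ x)) ∂(μ n)) / n)
        atTop (nhds (F t)))
    {ι : Type*} (K : Finset ι) (v : ι → Fin d → ℝ) (c : ι → ℝ) (t : Fin d → ℝ) {a : ℝ}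
    (ha : ∀ k ∈ K, F (t + v k) - c k < a) {S : Set (Fin d → ℝ)} (hS : MeasurableSet S)
    (hcov : ∀ x ∈ S, ∃ k ∈ K, c k ≤ v k ⬝ᵥ x) :
    ∀ᶠ n : ℕ in atTop, ∫ x in S, Real.exp (n * (t ⬝ᵥ x)) ∂(μ n) ≤ Real.exp (n * a) := by
  have hterm : ∀ k ∈ K, ∀ᶠ n : ℕ in atTop,
      ((K.card : ℝ) + 1) *
        (Real.exp (-(n * c k)) * ∫ x, Real.exp (n * ((t + v k) ⬝ᵥ x)) ∂(μ n)) ≤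
        Real.exp (n * a) := by
    intro k hk
    obtain ⟨b, hb, hba⟩ := exists_between (ha k hk)
    filter_upwards [Real.eventually_le_exp_of_tendsto_log_div
      (fun n => integral_exp_pos (hint n (t + v k))) (hF (t + v k))
      (show F (t + v k) < b + c k by linarith),
      Real.eventually_mul_exp_le_exp ((K.card : ℝ) + 1) hba] with n h1 h2
    refine le_trans ?_ h2
    have : Real.exp (n * b) = Real.exp (-(n * c k)) * Real.exp (n * (b + c k)) := by
      rw [← Real.exp_add]; ring_nf
    rw [this]
    gcongr
  filter_upwards [(eventually_all_finset K).2 hterm] with n hn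
  have hpt : ∀ x ∈ S, Real.exp (n * (t ⬝ᵥ x)) ≤
      ∑ k ∈ K, Real.exp (-(n * c k)) * Real.exp (n * ((t + v k) ⬝ᵥ x)) := by
    intro x hx
    obtain ⟨k, hk, hkx⟩ := hcov x hx
    refine le_trans ?_ (Finset.single_le_sum
      (f := fun k => Real.exp (-(n * c k)) * Real.exp (n * ((t + v k) ⬝ᵥ x)))
      (fun _ _ => by positivity) hk)
    rw [← Real.exp_add, add_dotProduct]
    have : (n : ℝ) * c k ≤ n * (v k ⬝ᵥ x) := by gcongr
    gcongr
    linarith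
  have hi : Integrable (fun x => ∑ k ∈ K, Real.exp (-(n * c k)) *
      Real.exp (n * ((t + v k) ⬝ᵥ x))) (μ n) :=
    integrable_finsetSum _ fun k _ => (hint n (t + v k)).const_mul _
  have hsum : ∫ x in S, Real.exp (n * (t ⬝ᵥ x)) ∂(μ n) ≤
      ∑ k ∈ K, Real.exp (-(n * c k)) * ∫ x, Real.exp (n * ((t + v k) ⬝ᵥ x)) ∂(μ n) := by
    calc _ ≤ ∫ x in S, ∑ k ∈ K, Real.exp (-(n * c k)) *
              Real.exp (n * ((t + v k) ⬝ᵥ x)) ∂(μ n) :=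
          setIntegral_mono_on (hint n t).integrableOn hi.integrableOn hS hpt
      _ ≤ ∫ x, ∑ k ∈ K, Real.exp (-(n * c k)) * Real.exp (n * ((t + v k) ⬝ᵥ x)) ∂(μ n) :=
          setIntegral_le_integral hi
            (Eventually.of_forall fun x => Finset.sum_nonneg fun _ _ => by positivity)
      _ = _ := by
          rw [integral_finsetSum _ fun k _ => (hint n (t + v k)).const_mul _]
          simp only [integral_const_mul]
  refine hsum.trans ?_
  have hcard : (0 : ℝ) < (K.card : ℝ) + 1 := by positivity
  have h1 := Finset.sum_le_card_nsmul K
    (fun k => Real.exp (-(n * c k)) * ∫ x, Real.exp (n * ((t + v k) ⬝ᵥ x)) ∂(μ n))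
    (Real.exp (n * a) / ((K.card : ℝ) + 1))
    (fun k hk => by rw [le_div_iff₀ hcard, mul_comm]; exact hn k hk)
  refine h1.trans ?_
  rw [nsmul_eq_mul, mul_div_assoc', div_le_iff₀ hcard]
  nlinarith [Real.exp_pos (n * a)]

lemma Pi.abs_dotProduct_le (t x : Fin d → ℝ) : |t ⬝ᵥ x| ≤ (∑ i, |t i|) * ‖x‖ := by
  rw [Finset.sum_mul]
  refine (Finset.abs_sum_le_sum_abs _ _).trans (Finset.sum_le_sum fun i _ => ?_)
  rw [abs_mul]
  gcongr
  exact norm_le_pi_norm x i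

lemma Pi.norm_sq_le_dotProduct_self (t : Fin d → ℝ) : ‖t‖ ^ 2 ≤ t ⬝ᵥ t := by
  have hnn : 0 ≤ t ⬝ᵥ t := Finset.sum_nonneg fun i _ => mul_self_nonneg _
  rw [← Real.le_sqrt (norm_nonneg _) hnn, pi_norm_le_iff_of_nonneg (Real.sqrt_nonneg _)]
  intro i
  refine Real.le_sqrt_of_sq_le ?_
  rw [Real.norm_eq_abs, sq_abs, sq]
  exact Finset.single_le_sum (f := fun i => t i * t i) (fun i _ => mul_self_nonneg _)
    (Finset.mem_univ i)

/-- Upper bound for an event on whose closure the Legendre transform of `F` exceeds `m`. -/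
lemma eventually_measureReal_le_exp [∀ n, IsProbabilityMeasure (μ n)]
    (hint : ∀ (n : ℕ) (t : Fin d → ℝ),
      Integrable (fun x : Fin d → ℝ => Real.exp (n * (t ⬝ᵥ x))) (μ n))
    (hF : ∀ t : Fin d → ℝ,
      Tendsto (fun n : ℕ => Real.log (∫ x, Real.exp (n * (t ⬝ᵥ x)) ∂(μ n)) / n)
        atTop (nhds (F t)))
    {B : Set (Fin d → ℝ)} (hB : MeasurableSet B) {m m' : ℝ} (hm : m < m')
    (h : ∀ x ∈ closure B, ∃ t : Fin d → ℝ, m' < t ⬝ᵥ x - F t) :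
    ∀ᶠ n : ℕ in atTop, (μ n).real B ≤ Real.exp (-(n * m)) := by
  classical
  let H : (Fin d → ℝ) → Set (Fin d → ℝ) := fun t => {x | m' < t ⬝ᵥ x - F t}
  have hopen : ∀ t, IsOpen (H t) := fun t =>
    isOpen_lt continuous_const (by unfold dotProduct; fun_prop)
  let e : Fin d × ℝ → Fin d → ℝ := fun p => Pi.single p.1 p.2
  let T₀ : Finset (Fin d → ℝ) := (Finset.univ ×ˢ {1, -1}).image e
  let C : Set (Fin d → ℝ) := closure B \ ⋃ t ∈ T₀, H t
  have hCcl : IsClosed C :=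
    isClosed_closure.sdiff (isOpen_biUnion fun t _ => hopen t)
  have hC : IsCompact C := by
    refine (isCompact_univ_pi fun i : Fin d => isCompact_Icc
      (a := -(m' + F (e (i, -1)))) (b := m' + F (e (i, 1)))).of_isClosed_subset hCcl ?_
    intro x hx i _
    have hx2 : ∀ σ : ℝ, σ = 1 ∨ σ = -1 → σ * x i - F (e (i, σ)) ≤ m' := by
      intro σ hσ
      by_contra! hlt
      refine hx.2 (Set.mem_biUnion (x := e (i, σ)) ?_ ?_)
      · exact Finset.mem_coe.2 (Finset.mem_image.2 ⟨(i, σ), by simpa using hσ, rfl⟩)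
      · simpa [H, e, single_dotProduct] using hlt
    constructor
    · linarith [hx2 (-1) (Or.inr rfl)]
    · linarith [hx2 1 (Or.inl rfl)]
  obtain ⟨T, hT⟩ := hC.elim_finite_subcover H hopen fun x hx =>
    Set.mem_iUnion.2 (h x hx.1)
  have key := eventually_setIntegral_exp_le hint hF (T₀ ∪ T) id (fun t => m' + F t) 0
    (a := -m) (fun k _ => by simp only [id, zero_add]; linarith) hB ?_
  · filter_upwards [key] with n hn
    simpa using hn
  · intro x hx
    have hxH : ∃ t ∈ T₀ ∪ T, x ∈ H t := by
      by_cases h0 : x ∈ ⋃ t ∈ T₀, H t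
      · obtain ⟨t, ht, hxt⟩ := Set.mem_iUnion₂.1 h0
        exact ⟨t, Finset.mem_union_left _ ht, hxt⟩
      · obtain ⟨t, ht, hxt⟩ := Set.mem_iUnion₂.1 (hT ⟨subset_closure hx, h0⟩)
        exact ⟨t, Finset.mem_union_right _ ht, hxt⟩
    obtain ⟨t, ht, hxt⟩ := hxH
    refine ⟨t, ht, ?_⟩
    have : m' < t ⬝ᵥ x - F t := hxt
    simp only [id]
    linarith

/-- Lower bound at a point `y` which is the gradient of `F` at some `t`. -/
lemma eventually_exp_le_measureReal_ball [∀ n, IsProbabilityMeasure (μ n)]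
    (hint : ∀ (n : ℕ) (t : Fin d → ℝ),
      Integrable (fun x : Fin d → ℝ => Real.exp (n * (t ⬝ᵥ x))) (μ n))
    (hF : ∀ t : Fin d → ℝ,
      Tendsto (fun n : ℕ => Real.log (∫ x, Real.exp (n * (t ⬝ᵥ x)) ∂(μ n)) / n)
        atTop (nhds (F t)))
    {t y : Fin d → ℝ} (hd : DifferentiableAt ℝ F t) (hy : ∀ v, fderiv ℝ F t v = v ⬝ᵥ y)
    {δ : ℝ} (hδ : 0 < δ) {r : ℝ} (hr : t ⬝ᵥ y - F t + (∑ i, |t i|) * δ < r) :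
    ∀ᶠ n : ℕ in atTop, Real.exp (-(n * r)) ≤ (μ n).real (Metric.ball y δ) := by
  obtain ⟨s, hs, hsF⟩ : ∃ s : ℝ, 0 < s ∧ ∀ v : Fin d → ℝ, ‖v‖ ≤ s →
      F (t + v) - F t - v ⬝ᵥ y ≤ δ / 2 * s := by
    have := hd.hasFDerivAt.isLittleO.def (half_pos hδ)
    obtain ⟨s, hs, hball⟩ := Metric.eventually_nhds_iff.1 this
    refine ⟨s / 2, half_pos hs, fun v hv => ?_⟩
    have h1 := hball (y := t + v) (by rw [dist_eq_norm, add_sub_cancel_left]; linarith)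
    rw [add_sub_cancel_left, hy] at h1
    exact (le_abs_self _).trans (h1.trans (by gcongr))
  set A := ∑ i, |t i|
  have hcov : ∀ x ∈ (Metric.ball y δ)ᶜ, ∃ p ∈ (Finset.univ ×ˢ {s, -s} : Finset (Fin d × ℝ)),
      (Pi.single p.1 p.2 : Fin d → ℝ) ⬝ᵥ y + s * δ ≤ (Pi.single p.1 p.2 : Fin d → ℝ) ⬝ᵥ x := by
    intro x hx
    have hx' : ¬ dist x y < δ := hx
    rw [dist_pi_lt_iff hδ] at hx'
    push Not at hx'
    obtain ⟨i, hi⟩ := hx'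
    rw [Real.dist_eq] at hi
    rcases le_abs.1 hi with hi | hi
    · refine ⟨(i, s), by simp, ?_⟩
      simp only [single_dotProduct]
      nlinarith
    · refine ⟨(i, -s), by simp, ?_⟩
      simp only [single_dotProduct]
      nlinarith
  have hup := eventually_setIntegral_exp_le hint hF (Finset.univ ×ˢ {s, -s})
    (fun p => Pi.single p.1 p.2) (fun p => (Pi.single p.1 p.2 : Fin d → ℝ) ⬝ᵥ y + s * δ) t
    (a := F t - s * δ / 4) (fun p hp => ?_) Metric.isOpen_ball.measurableSet.compl hcov
  swap
  · have hp2 : p.2 = s ∨ p.2 = -s := by simpa using hp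
    have hnorm : ‖(Pi.single p.1 p.2 : Fin d → ℝ)‖ ≤ s := by
      rw [Pi.norm_single, Real.norm_eq_abs]
      rcases hp2 with h | h <;> simp [h, abs_of_pos hs]
    have := hsF _ hnorm
    have : 0 < s * δ := by positivity
    linarith
  have hsδ : 0 < s * δ := by positivity
  obtain ⟨b, hb, hbF⟩ := exists_between
    (show max (F t - s * δ / 4) (t ⬝ᵥ y + A * δ - r) < F t from max_lt (by linarith) (by linarith))
  obtain ⟨hb1, hb2⟩ := max_lt_iff.1 hb
  filter_upwards [hup, Real.eventually_exp_le_of_tendsto_log_div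
      (fun n => integral_exp_pos (hint n t)) (hF t) hbF,
    Real.eventually_mul_exp_le_exp 2 hb1, Real.eventually_mul_exp_le_exp 2 hb2] with n h1 h2 h3 h4
  have hsplit := integral_add_compl (μ := μ n) (s := Metric.ball y δ)
    Metric.isOpen_ball.measurableSet (hint n t)
  have hin : ∫ x in Metric.ball y δ, Real.exp (n * (t ⬝ᵥ x)) ∂(μ n) ≤
      (μ n).real (Metric.ball y δ) * Real.exp (n * (t ⬝ᵥ y + A * δ)) := by
    calc _ ≤ ∫ x in Metric.ball y δ, Real.exp (n * (t ⬝ᵥ y + A * δ)) ∂(μ n) := by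
          refine setIntegral_mono_on (hint n t).integrableOn (integrable_const _)
            Metric.isOpen_ball.measurableSet fun x hx => ?_
          have h5 := (le_abs_self _).trans (Pi.abs_dotProduct_le t (x - y))
          rw [dotProduct_sub] at h5
          have h6 : ‖x - y‖ ≤ δ := by rw [← dist_eq_norm]; exact (Metric.mem_ball.1 hx).le
          have h7 : A * ‖x - y‖ ≤ A * δ := by gcongr
          gcongr
          linarith
      _ = _ := by simp
  have h8 : Real.exp (n * (t ⬝ᵥ y + A * δ - r)) =
      Real.exp (-(n * r)) * Real.exp (n * (t ⬝ᵥ y + A * δ)) := by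
    rw [← Real.exp_add]; ring_nf
  refine le_of_mul_le_mul_right ?_ (Real.exp_pos (n * (t ⬝ᵥ y + A * δ)))
  rw [← h8]
  linarith

/-- A point where the Legendre transform of `F` is finite is approximated by gradients of `F`,
without increasing the Legendre transform. -/
lemma exists_fderiv_eq_dotProduct_near (hF : Differentiable ℝ F) {x : Fin d → ℝ} {c : ℝ}
    (hc : ∀ t, t ⬝ᵥ x - F t ≤ c) {δ : ℝ} (hδ : 0 < δ) :
    ∃ t y : Fin d → ℝ, (∀ v, fderiv ℝ F t v = v ⬝ᵥ y) ∧ dist y x < δ ∧ t ⬝ᵥ y - F t ≤ c := by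
  have hc0 : 0 ≤ c + F 0 := by have := hc 0; rw [zero_dotProduct] at this; linarith
  obtain ⟨ε, hε, hεδ⟩ : ∃ ε : ℝ, 0 < ε ∧ 2 * ε * (c + F 0) < δ ^ 2 := by
    refine ⟨δ ^ 2 / (2 * (c + F 0 + 1)), by positivity, ?_⟩
    rw [show 2 * (δ ^ 2 / (2 * (c + F 0 + 1))) * (c + F 0) =
      δ ^ 2 * (c + F 0) / (c + F 0 + 1) by field_simp, div_lt_iff₀ (by positivity)]
    nlinarith [sq_pos_of_pos hδ]
  let G : (Fin d → ℝ) → ℝ := fun t => F t - t ⬝ᵥ x + ε / 2 * (t ⬝ᵥ t)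
  have hGc : Continuous G := by
    have := hF.continuous
    simp only [G, dotProduct]
    fun_prop
  have hGt : Tendsto G (cocompact _) atTop := by
    have h1 : Tendsto (fun t : Fin d → ℝ => ε / 2 * ‖t‖ ^ 2 + -c) (cocompact _) atTop :=
      tendsto_atTop_add_const_right _ _ (((tendsto_pow_atTop two_ne_zero).comp
        (tendsto_norm_cocompact_atTop (E := Fin d → ℝ))).const_mul_atTop (half_pos hε))
    refine tendsto_atTop_mono (fun t => ?_) h1
    have h2 := Pi.norm_sq_le_dotProduct_self t
    have h3 : ε / 2 * ‖t‖ ^ 2 ≤ ε / 2 * (t ⬝ᵥ t) := by gcongr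
    simp only [G]
    linarith [hc t]
  obtain ⟨t, ht⟩ := hGc.exists_forall_le hGt
  have htt := Pi.norm_sq_le_dotProduct_self t
  have htt0 : 0 ≤ t ⬝ᵥ t := (sq_nonneg _).trans htt
  refine ⟨t, x - ε • t, fun v => ?_, ?_, ?_⟩
  · have hline : HasDerivAt (fun s : ℝ => t + s • v) v 0 := by
      simpa using ((hasDerivAt_id (0 : ℝ)).smul_const v).const_add t
    have h1 : HasDerivAt (fun s : ℝ => F (t + s • v)) (fderiv ℝ F t v) 0 := by
      refine HasFDerivAt.comp_hasDerivAt (0 : ℝ) ?_ hline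
      simpa using (hF t).hasFDerivAt
    have h2 : HasDerivAt (fun s : ℝ => - (t ⬝ᵥ x + s * (v ⬝ᵥ x)) +
        ε / 2 * (t ⬝ᵥ t + s * (2 * (t ⬝ᵥ v)) + s ^ 2 * (v ⬝ᵥ v)))
        (-(v ⬝ᵥ x) + ε / 2 * (2 * (t ⬝ᵥ v))) 0 := by
      have ha := (((hasDerivAt_id (0 : ℝ)).mul_const (v ⬝ᵥ x)).const_add (t ⬝ᵥ x)).neg
      have hb := ((((hasDerivAt_id (0 : ℝ)).mul_const (2 * (t ⬝ᵥ v))).const_add (t ⬝ᵥ t)).add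
        ((hasDerivAt_pow 2 (0 : ℝ)).mul_const (v ⬝ᵥ v))).const_mul (ε / 2)
      exact (ha.add hb).congr_deriv (by simp)
    have h3 : HasDerivAt (fun s : ℝ => G (t + s • v))
        (fderiv ℝ F t v + (-(v ⬝ᵥ x) + ε / 2 * (2 * (t ⬝ᵥ v)))) 0 := by
      refine (h1.add h2).congr_of_eventuallyEq (Eventually.of_forall fun s => ?_)
      simp only [G, Pi.add_apply, add_dotProduct, dotProduct_add, smul_dotProduct,
        dotProduct_smul, smul_eq_mul, dotProduct_comm v t]
      ring
    have h4 : IsLocalMin (fun s : ℝ => G (t + s • v)) 0 :=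
      Eventually.of_forall fun s => by simpa using ht (t + s • v)
    have h5 := h4.hasDerivAt_eq_zero h3
    rw [dotProduct_sub, dotProduct_smul, smul_eq_mul, dotProduct_comm v t]
    linarith
  · have h1 : ε / 2 * (t ⬝ᵥ t) ≤ F 0 + c := by
      have := ht 0
      simp only [G, zero_dotProduct] at this
      linarith [hc t]
    have h2 : dist (x - ε • t) x = ε * ‖t‖ := by
      rw [dist_eq_norm, sub_sub_cancel_left, norm_neg, norm_smul, Real.norm_eq_abs, abs_of_pos hε]
    rw [h2]
    refine lt_of_pow_lt_pow_left₀ 2 hδ.le ?_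
    calc (ε * ‖t‖) ^ 2 = ε ^ 2 * ‖t‖ ^ 2 := by ring
      _ ≤ ε ^ 2 * (t ⬝ᵥ t) := by gcongr
      _ = 2 * ε * (ε / 2 * (t ⬝ᵥ t)) := by ring
      _ ≤ 2 * ε * (F 0 + c) := by gcongr
      _ < δ ^ 2 := by linarith
  · rw [dotProduct_sub, dotProduct_smul, smul_eq_mul]
    nlinarith [hc t, mul_nonneg hε.le htt0]

end Tilting

lemma EReal.inv_mul_ennreal_log_ofReal_exp {n : ℕ} (hn : 0 < n) (m : ℝ) :
    (((n : ℝ)⁻¹ : ℝ) : EReal) * ENNReal.log (ENNReal.ofReal (Real.exp (-(n * m)))) =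
      ((-m : ℝ) : EReal) := by
  have hn' : (n : ℝ) ≠ 0 := by exact_mod_cast hn.ne'
  rw [ENNReal.log_ofReal_of_pos (Real.exp_pos _), Real.log_exp, ← EReal.coe_mul]
  congr 1
  field_simp



/-- **Gärtner–Ellis theorem.** Let `(μₙ)` be Borel probability measures on `ℝ^d` with moment
generating functions `Γₙ(t) = ∫ exp(n⟨t,x⟩) dμₙ(x)`. If `F(t) = lim (1/n) log Γₙ(t)` exists,
is finite for every `t`, and is differentiable, then `(μₙ)` satisfies a large deviation
principle with rate function `I(x) = sup_t (⟨t,x⟩ − F(t))`. -/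
theorem gartner_ellis {d : ℕ}
    (μ : ℕ → Measure (Fin d → ℝ)) (hμ : ∀ n, IsProbabilityMeasure (μ n))
    -- the moment generating functions are finite
    (hint : ∀ (n : ℕ) (t : Fin d → ℝ),
      Integrable (fun x : Fin d → ℝ => Real.exp (n * ∑ i, t i * x i)) (μ n))
    (F : (Fin d → ℝ) → ℝ)
    -- `F(t) = lim (1/n) log Γₙ(t)` exists and is finite for every `t`
    (hF : ∀ t : Fin d → ℝ,
      Tendsto (fun n : ℕ =>
          Real.log (∫ x : Fin d → ℝ, Real.exp (n * ∑ i, t i * x i) ∂(μ n)) / n)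
        atTop (nhds (F t)))
    -- `F` is differentiable
    (hFdiff : Differentiable ℝ F)
    -- the rate function `I(x) = sup_t (⟨t,x⟩ − F(t))`, with values in `[0, ∞]`
    (I : (Fin d → ℝ) → EReal)
    (hI : ∀ x, I x = ⨆ t : Fin d → ℝ, (((∑ i, t i * x i) - F t : ℝ) : EReal)) :
    -- large deviation principle
    ∀ B : Set (Fin d → ℝ), MeasurableSet B →
      (-(⨅ x ∈ interior B, I x) ≤
          liminf (fun n : ℕ => (((n : ℝ)⁻¹ : ℝ) : EReal) * ENNReal.log (μ n B)) atTop) ∧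
      (limsup (fun n : ℕ => (((n : ℝ)⁻¹ : ℝ) : EReal) * ENNReal.log (μ n B)) atTop ≤
          -(⨅ x ∈ closure B, I x)) := by
  intro B hB
  have hI' : ∀ x, I x = ⨆ t : Fin d → ℝ, ((t ⬝ᵥ x - F t : ℝ) : EReal) := hI
  have hmono : ∀ {n : ℕ} {p q : ENNReal}, p ≤ q →
      (((n : ℝ)⁻¹ : ℝ) : EReal) * ENNReal.log p ≤ (((n : ℝ)⁻¹ : ℝ) : EReal) * ENNReal.log q :=
    fun h => mul_le_mul_of_nonneg_left (ENNReal.log_monotone h)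
      (EReal.coe_nonneg.2 (by positivity))
  constructor
  · rw [EReal.neg_le]
    refine le_iInf₂ fun x hx => ?_
    refine EReal.le_of_forall_lt_iff_le.1 fun r hr => ?_
    obtain ⟨c, hc, hcr⟩ := EReal.lt_iff_exists_real_btwn.1 hr
    have hcr' : c < r := EReal.coe_lt_coe_iff.1 hcr
    have hxc : ∀ t : Fin d → ℝ, t ⬝ᵥ x - F t ≤ c := fun t =>
      EReal.coe_le_coe_iff.1 (((le_iSup (fun t : Fin d → ℝ => ((t ⬝ᵥ x - F t : ℝ) : EReal)) t).trans
        (hI' x).ge).trans hc.le)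
    obtain ⟨δ, hδ, hball⟩ := Metric.isOpen_iff.1 isOpen_interior x hx
    obtain ⟨t, y, hty, hyx, hyc⟩ := exists_fderiv_eq_dotProduct_near hFdiff hxc hδ
    obtain ⟨η, hη, hηδ, hηr⟩ : ∃ η : ℝ, 0 < η ∧ η ≤ δ - dist y x ∧
        (∑ i, |t i|) * η < r - c := by
      have hA : 0 ≤ ∑ i, |t i| := Finset.sum_nonneg fun i _ => abs_nonneg _
      refine ⟨min (δ - dist y x) ((r - c) / (∑ i, |t i| + 1)),
        lt_min (by linarith) (div_pos (by linarith) (by linarith)), min_le_left _ _, ?_⟩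
      calc (∑ i, |t i|) * min (δ - dist y x) ((r - c) / (∑ i, |t i| + 1))
          ≤ (∑ i, |t i|) * ((r - c) / (∑ i, |t i| + 1)) := by
            gcongr
            exact min_le_right _ _
        _ < r - c := by
            rw [mul_div_assoc', div_lt_iff₀ (by linarith)]
            nlinarith
    have hsub : Metric.ball y η ⊆ B :=
      (Metric.ball_subset_ball' (by linarith)).trans (hball.trans interior_subset)
    rw [EReal.neg_le]
    refine le_liminf_of_le (by isBoundedDefault) ?_
    filter_upwards [eventually_exp_le_measureReal_ball hint hF (hFdiff t) hty hη
      (show _ < r by linarith), eventually_gt_atTop 0] with n hn hn0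
    rw [← EReal.coe_neg, ← EReal.inv_mul_ennreal_log_ofReal_exp hn0 r]
    refine hmono ?_
    calc ENNReal.ofReal (Real.exp (-(n * r))) ≤ ENNReal.ofReal ((μ n).real (Metric.ball y η)) :=
          ENNReal.ofReal_le_ofReal hn
      _ = μ n (Metric.ball y η) := ofReal_measureReal
      _ ≤ μ n B := measure_mono hsub
  · rw [EReal.le_neg]
    refine EReal.ge_of_forall_gt_iff_ge.1 fun m hm => ?_
    obtain ⟨m', hmm', hm'⟩ := EReal.lt_iff_exists_real_btwn.1 hm
    rw [EReal.le_neg, ← EReal.coe_neg]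
    refine limsup_le_of_le (by isBoundedDefault) ?_
    have hB' : ∀ x ∈ closure B, ∃ t : Fin d → ℝ, m' < t ⬝ᵥ x - F t := by
      intro x hx
      have h1 : (m' : EReal) < I x := hm'.trans_le (iInf₂_le x hx)
      rw [hI', lt_iSup_iff] at h1
      obtain ⟨t, ht⟩ := h1
      exact ⟨t, EReal.coe_lt_coe_iff.1 ht⟩
    filter_upwards [eventually_measureReal_le_exp hint hF hB (EReal.coe_lt_coe_iff.1 hmm') hB',
      eventually_gt_atTop 0] with n hn hn0
    rw [← EReal.inv_mul_ennreal_log_ofReal_exp hn0 m]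
    refine hmono ?_
    rw [← ofReal_measureReal (μ := μ n) (s := B)]
    exact ENNReal.ofReal_le_ofReal hn
end
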